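/- arXiv:1506.05305 — 8 statements merged into one kernel-verified Lean document; each statement's English description precedes it below -/
import Mathlib

section
/- Let Ω ⊆ ℝ^n be open, let f : Ω × ℝ → ℝ be continuous, and let u ∈ C(Ω) be a viscosity solution of −Δ∞ u = f(x,u) in Ω. If u is locally semiconcave in Ω, then u is differentiable at every point of Ω, and hence u ∈ C¹(Ω). -/
open Set Metric Filter
open scoped RealInnerProductSpace

noncomputable section

/-- The Hessian of `φ` at `x`, as the Fréchet derivative of the gradient. -/
def hessianCLM {n : ℕ} (φ : EuclideanSpace ℝ (Fin n) → ℝ) (x : EuclideanSpace ℝ (Fin n)) :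
    EuclideanSpace ℝ (Fin n) →L[ℝ] EuclideanSpace ℝ (Fin n) :=
  fderiv ℝ (gradient φ) x

/-- The maximum eigenvalue of a symmetric operator, as the supremum of the
quadratic form over unit vectors. -/
def lamMax {n : ℕ} (A : EuclideanSpace ℝ (Fin n) →L[ℝ] EuclideanSpace ℝ (Fin n)) : ℝ :=
  sSup ((fun v => ⟪A v, v⟫) '' {v | ‖v‖ = 1})

/-- The minimum eigenvalue of a symmetric operator, as the infimum of the
quadratic form over unit vectors. -/
def lamMin {n : ℕ} (A : EuclideanSpace ℝ (Fin n) →L[ℝ] EuclideanSpace ℝ (Fin n)) : ℝ :=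
  sInf ((fun v => ⟪A v, v⟫) '' {v | ‖v‖ = 1})

/-- The (not normalized) infinity Laplacian `Δ∞φ(x) = ⟨∇²φ(x) ∇φ(x), ∇φ(x)⟩`. -/
def infLap {n : ℕ} (φ : EuclideanSpace ℝ (Fin n) → ℝ) (x : EuclideanSpace ℝ (Fin n)) : ℝ :=
  ⟪hessianCLM φ x (gradient φ x), gradient φ x⟫

/-- Viscosity subsolution of `-Δ∞^N u = f` in `Ω`. -/
def IsNSubsol {n : ℕ} (Ω : Set (EuclideanSpace ℝ (Fin n))) (f : EuclideanSpace ℝ (Fin n) → ℝ)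
    (u : EuclideanSpace ℝ (Fin n) → ℝ) : Prop :=
  UpperSemicontinuousOn u Ω ∧
  ∀ x ∈ Ω, ∀ φ : EuclideanSpace ℝ (Fin n) → ℝ, ContDiffOn ℝ 2 φ Ω →
    φ x = u x → (∀ y ∈ Ω, u y ≤ φ y) →
    (gradient φ x ≠ 0 → -infLap φ x ≤ f x * ‖gradient φ x‖ ^ 2) ∧
    (gradient φ x = 0 → -lamMax (hessianCLM φ x) ≤ f x)

/-- Viscosity supersolution of `-Δ∞^N u = f` in `Ω`. -/
def IsNSupersol {n : ℕ} (Ω : Set (EuclideanSpace ℝ (Fin n))) (f : EuclideanSpace ℝ (Fin n) → ℝ)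
    (u : EuclideanSpace ℝ (Fin n) → ℝ) : Prop :=
  LowerSemicontinuousOn u Ω ∧
  ∀ x ∈ Ω, ∀ φ : EuclideanSpace ℝ (Fin n) → ℝ, ContDiffOn ℝ 2 φ Ω →
    φ x = u x → (∀ y ∈ Ω, φ y ≤ u y) →
    (gradient φ x ≠ 0 → f x * ‖gradient φ x‖ ^ 2 ≤ -infLap φ x) ∧
    (gradient φ x = 0 → f x ≤ -lamMin (hessianCLM φ x))

/-- Viscosity solution of the Dirichlet problem `-Δ∞^N u = 1` in `Ω`, `u = 0` on `∂Ω`. -/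
def IsDirichletSol {n : ℕ} (Ω : Set (EuclideanSpace ℝ (Fin n)))
    (u : EuclideanSpace ℝ (Fin n) → ℝ) : Prop :=
  ContinuousOn u (closure Ω) ∧ (∀ x ∈ frontier Ω, u x = 0) ∧
  IsNSubsol Ω (fun _ => 1) u ∧ IsNSupersol Ω (fun _ => 1) u

/-- `u` is semiconcave with constant `C` on `K`. -/
def SemiconcaveWith {n : ℕ} (C : ℝ) (K : Set (EuclideanSpace ℝ (Fin n)))
    (u : EuclideanSpace ℝ (Fin n) → ℝ) : Prop :=
  ∀ x ∈ K, ∀ y ∈ K, ∀ t : ℝ, 0 ≤ t → t ≤ 1 →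
    t * u x + (1 - t) * u y - C / 2 * (t * (1 - t)) * ‖x - y‖ ^ 2 ≤ u (t • x + (1 - t) • y)

/-- `u` is locally semiconcave in `Ω`: semiconcave (with some constant) on every
compact convex subset of `Ω`. -/
def LocallySemiconcaveOn {n : ℕ} (Ω : Set (EuclideanSpace ℝ (Fin n)))
    (u : EuclideanSpace ℝ (Fin n) → ℝ) : Prop :=
  ∀ K ⊆ Ω, IsCompact K → Convex ℝ K → ∃ C : ℝ, SemiconcaveWith C K u

/-- The function `F(w,p,A) = -⟨Ap,p⟩ - (1/w)(|p|⁴ + |p|²/2)`. -/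
def Ffun {n : ℕ} (w : ℝ) (p : EuclideanSpace ℝ (Fin n))
    (A : EuclideanSpace ℝ (Fin n) →L[ℝ] EuclideanSpace ℝ (Fin n)) : ℝ :=
  -⟪A p, p⟫ - (1 / w) * (‖p‖ ^ 4 + 1 / 2 * ‖p‖ ^ 2)

/-- Restricted viscosity supersolution of `F(w,∇w,∇²w) = 0` in `Ω`. -/
def IsRestrictedSupersol {n : ℕ} (Ω : Set (EuclideanSpace ℝ (Fin n)))
    (w : EuclideanSpace ℝ (Fin n) → ℝ) : Prop :=
  LowerSemicontinuousOn w Ω ∧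
  ∀ x ∈ Ω, ∀ ψ : EuclideanSpace ℝ (Fin n) → ℝ, ContDiffOn ℝ 2 ψ Ω →
    ψ x = w x → (∀ y ∈ Ω, ψ y ≤ w y) →
    0 ≤ Ffun (w x) (gradient ψ x) (hessianCLM ψ x) ∧
    (gradient ψ x = 0 → lamMin (hessianCLM ψ x) ≤ -1 / (2 * w x))

/-- Restricted viscosity subsolution of `F(w,∇w,∇²w) = 0` in `Ω`. -/
def IsRestrictedSubsol {n : ℕ} (Ω : Set (EuclideanSpace ℝ (Fin n)))
    (w : EuclideanSpace ℝ (Fin n) → ℝ) : Prop :=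
  UpperSemicontinuousOn w Ω ∧
  ∀ x ∈ Ω, ∀ ψ : EuclideanSpace ℝ (Fin n) → ℝ, ContDiffOn ℝ 2 ψ Ω →
    ψ x = w x → (∀ y ∈ Ω, w y ≤ ψ y) →
    Ffun (w x) (gradient ψ x) (hessianCLM ψ x) ≤ 0 ∧
    (gradient ψ x = 0 → -1 / (2 * w x) ≤ lamMax (hessianCLM ψ x))

/-- `Ω` satisfies an interior sphere condition. -/
def InteriorSphere {n : ℕ} (Ω : Set (EuclideanSpace ℝ (Fin n))) : Prop :=
  ∀ z ∈ frontier Ω, ∃ y R, 0 < R ∧ ball y R ⊆ Ω ∧ z ∈ sphere y R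

/-- The superdifferential of `u` at `x₀` (relative to `Ω`). -/
def superDiff {n : ℕ} (Ω : Set (EuclideanSpace ℝ (Fin n)))
    (u : EuclideanSpace ℝ (Fin n) → ℝ) (x₀ : EuclideanSpace ℝ (Fin n)) :
    Set (EuclideanSpace ℝ (Fin n)) :=
  {p | ∀ ε > 0, ∃ δ > 0, ∀ x ∈ Ω, ‖x - x₀‖ < δ →
    u x - u x₀ - ⟪p, x - x₀⟫ ≤ ε * ‖x - x₀‖}

end

section ConvexSubgradient

variable {E : Type*} [NormedAddCommGroup E] [NormedSpace ℝ E]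

open scoped Topology

/-- `l` is a subgradient at `x` of the function `g` on the set `s`. -/
def IsSubgradientOn (g : E → ℝ) (s : Set E) (x : E) (l : E →L[ℝ] ℝ) : Prop :=
  ∀ y ∈ s, g x + l (y - x) ≤ g y

/-- A continuous convex function on an open set has a subgradient at every point. -/
theorem ConvexOn.exists_isSubgradientOn {g : E → ℝ} {s : Set E} (hs : IsOpen s)
    (hg : ConvexOn ℝ s g) (hc : ContinuousOn g s) {x : E} (hx : x ∈ s) :
    ∃ l : E →L[ℝ] ℝ, IsSubgradientOn g s x l := by
  have hopen : IsOpen {q : E × ℝ | q.1 ∈ s ∧ g q.1 < q.2} := by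
    have hsU : IsOpen (s ×ˢ (univ : Set ℝ)) := hs.prod isOpen_univ
    have h1 : ContinuousOn (fun q : E × ℝ => q.2 - g q.1) (s ×ˢ (univ : Set ℝ)) :=
      continuousOn_snd.sub (hc.comp continuousOn_fst fun q hq => hq.1)
    have h2 := h1.isOpen_inter_preimage hsU (isOpen_Ioi (a := (0 : ℝ)))
    convert h2 using 1
    ext q
    simp
  obtain ⟨F, hF⟩ := geometric_hahn_banach_point_open (x := (x, g x)) hg.convex_strict_epigraph
    hopen (by simp)
  have hdec : ∀ y a, F (y, a) = F (y, 0) + a * F (0, 1) := by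
    intro y a
    have : ((y, a) : E × ℝ) = (y, 0) + a • (0, 1) := by simp
    rw [this, map_add, map_smul, smul_eq_mul]
  have hpos : 0 < F (0, 1) := by
    have h := hF (x, g x + 1) ⟨hx, by simp⟩
    rw [hdec x (g x), hdec x (g x + 1)] at h
    linarith
  refine ⟨-((F (0, 1))⁻¹ • F.comp (ContinuousLinearMap.inl ℝ E ℝ)), fun y hy => ?_⟩
  have key : F (x, 0) + g x * F (0, 1) ≤ F (y, 0) + g y * F (0, 1) := by
    refine le_of_forall_pos_lt_add fun ε hε => ?_
    have h := hF (y, g y + ε / F (0, 1)) ⟨hy, by simp; positivity⟩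
    rw [hdec x (g x), hdec y (g y + _)] at h
    have : ε / F (0, 1) * F (0, 1) = ε := div_mul_cancel₀ _ hpos.ne'
    linarith
  have hsubF : F (y - x, 0) = F (y, 0) - F (x, 0) := by
    rw [← map_sub]
    simp
  simp only [neg_apply, smul_apply, ContinuousLinearMap.comp_apply,
    ContinuousLinearMap.inl_apply, smul_eq_mul, hsubF]
  have : (F (0, 1))⁻¹ * (F (y, 0) - F (x, 0)) = (F (y, 0) - F (x, 0)) / F (0, 1) := by
    rw [div_eq_inv_mul]
  rw [this]
  have : g x - g y ≤ (F (y, 0) - F (x, 0)) / F (0, 1) := by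
    rw [le_div_iff₀ hpos]
    linarith
  linarith

/-- In finite dimension, a selection of unique subgradients of a continuous function is
continuous. -/
theorem continuousOn_of_unique_isSubgradientOn [FiniteDimensional ℝ E] {g : E → ℝ} {s : Set E}
    (hs : IsOpen s) (hc : ContinuousOn g s) {p : E → E →L[ℝ] ℝ}
    (hp : ∀ x ∈ s, IsSubgradientOn g s x (p x))
    (huniq : ∀ x ∈ s, ∀ l, IsSubgradientOn g s x l → l = p x) : ContinuousOn p s := by
  intro x₀ hx₀
  refine ContinuousAt.continuousWithinAt ?_
  have hcx := hc.continuousAt (hs.mem_nhds hx₀)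
  have hbd : ∀ᶠ x in 𝓝 x₀, x ∈ s ∧ g x ∈ ball (g x₀) 1 :=
    (hs.eventually_mem hx₀).and (hcx.eventually (ball_mem_nhds _ one_pos))
  obtain ⟨δ, hδ, hball⟩ := Metric.eventually_nhds_iff_ball.1 hbd
  have hbound : ∀ᶠ x in 𝓝 x₀, p x ∈ closedBall 0 (2 / (δ / 4)) := by
    filter_upwards [ball_mem_nhds x₀ (half_pos hδ)] with x hx
    rw [mem_closedBall_zero_iff]
    have hupper : ∀ v : E, ‖v‖ ≤ δ / 4 → p x v ≤ 2 := by
      intro v hv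
      have hx' : x ∈ ball x₀ δ := ball_subset_ball (by linarith) hx
      have hxv : x + v ∈ ball x₀ δ := by
        rw [mem_ball_iff_norm] at hx ⊢
        calc ‖x + v - x₀‖ = ‖(x - x₀) + v‖ := by congr 1; abel
          _ ≤ ‖x - x₀‖ + ‖v‖ := norm_add_le _ _
          _ < δ := by linarith
      have h := hp x (hball x hx').1 (x + v) (hball _ hxv).1
      have h1 := (hball x hx').2
      have h2 := (hball _ hxv).2
      rw [Real.ball_eq_Ioo] at h1 h2
      rw [add_sub_cancel_left] at h
      linarith [h1.1, h2.2]
    refine (p x).opNorm_le_bound (by positivity) fun z => ?_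
    refine LinearMap.bound_of_ball_bound' (by positivity) 2 (p x : E →ₗ[ℝ] ℝ) (fun v hv => ?_) z
    rw [mem_closedBall_zero_iff] at hv
    have h := hupper (-v) (by rwa [norm_neg])
    rw [map_neg] at h
    exact abs_le.2 ⟨by simpa using neg_le.1 h, hupper v hv⟩
  rw [ContinuousAt, tendsto_iff_ultrafilter]
  intro U hU
  obtain ⟨l, -, hl⟩ := (isCompact_closedBall (0 : E →L[ℝ] ℝ) (2 / (δ / 4))).ultrafilter_le_nhds
    (U.map p) (le_principal_iff.2 (hU hbound))
  have hsubl : IsSubgradientOn g s x₀ l := by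
    intro y hy
    have hlim : Tendsto (fun x => g x + p x (y - x)) U (𝓝 (g x₀ + l (y - x₀))) := by
      refine (hcx.mono_left hU).add ?_
      have h1 : Tendsto p U (𝓝 l) := hl
      have h2 : Tendsto (fun x => y - x) U (𝓝 (y - x₀)) :=
        (tendsto_const_nhds.sub tendsto_id).mono_left hU
      exact ((isBoundedBilinearMap_apply (𝕜 := ℝ) (E := E) (F := ℝ)).continuous.tendsto
        (l, y - x₀)).comp (h1.prodMk_nhds h2)
    refine le_of_tendsto hlim (hU ?_)
    filter_upwards [hs.mem_nhds hx₀] with x hx using hp x hx y hy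
  rw [← huniq x₀ hx₀ l hsubl]
  exact hl

/-- A function with a continuous selection of subgradients is differentiable. -/
theorem hasFDerivAt_of_continuousOn_isSubgradientOn {g : E → ℝ} {s : Set E}
    (hs : IsOpen s) {p : E → E →L[ℝ] ℝ} (hp : ∀ x ∈ s, IsSubgradientOn g s x (p x))
    (hpc : ContinuousOn p s) {x : E} (hx : x ∈ s) : HasFDerivAt g (p x) x := by
  rw [hasFDerivAt_iff_isLittleO, Asymptotics.isLittleO_iff]
  intro ε hε
  filter_upwards [hs.mem_nhds hx,
    (hpc.continuousAt (hs.mem_nhds hx)).eventually (ball_mem_nhds _ hε)] with y hy hyε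
  have h1 := hp x hx y hy
  have h2 := hp y hy x hx
  have h3 : p y (x - y) = - p y (y - x) := by rw [← map_neg, neg_sub]
  have h4 : (p y - p x) (y - x) ≤ ε * ‖y - x‖ :=
    (le_abs_self _).trans (((p y - p x).le_opNorm _).trans
      (mul_le_mul_of_nonneg_right (mem_ball_iff_norm.1 hyε).le (norm_nonneg _)))
  rw [sub_apply] at h4
  rw [Real.norm_eq_abs, abs_le]
  constructor <;> nlinarith [norm_nonneg (y - x)]

/-- A continuous convex function on an open set of a finite-dimensional space whose subgradients
are unique is continuously differentiable. -/
theorem ConvexOn.contDiffAt_one_of_unique_isSubgradientOn [FiniteDimensional ℝ E] {g : E → ℝ}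
    {s : Set E} (hs : IsOpen s) (hg : ConvexOn ℝ s g) (hc : ContinuousOn g s)
    (huniq : ∀ x ∈ s, ∀ l l', IsSubgradientOn g s x l → IsSubgradientOn g s x l' → l = l')
    {x : E} (hx : x ∈ s) : ContDiffAt ℝ 1 g x := by
  choose! p hp using fun x (hx : x ∈ s) => hg.exists_isSubgradientOn hs hc hx
  have hpc : ContinuousOn p s := continuousOn_of_unique_isSubgradientOn hs hc hp
    fun x hx l hl => huniq x hx l (p x) hl (hp x hx)
  exact contDiffAt_one_iff.2 ⟨p, s, hs.mem_nhds hx, hpc, fun y hy =>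
    hasFDerivAt_of_continuousOn_isSubgradientOn hs hp hpc hy⟩

end ConvexSubgradient

section TouchingFunction

variable {E : Type*} [NormedAddCommGroup E] [InnerProductSpace ℝ E] [FiniteDimensional ℝ E]

open scoped Topology Manifold ContDiff

/-- A smooth function lying above a continuous function `u` near `x`
can be modified away from `x` to lie above `u` on a whole open set. -/
theorem exists_contDiffOn_eventuallyEq_le {Ω : Set E} (hΩ : IsOpen Ω) {u P : E → ℝ}
    (hu : ContinuousOn u Ω) (hP : ContDiff ℝ 2 P) {x : E} {r : ℝ} (hr : 0 < r)
    (hle : ∀ y ∈ Ω, y ∈ ball x r → u y ≤ P y) :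
    ∃ φ : E → ℝ, (∀ y ∈ Ω, y ∈ ball x (r / 2) → φ y = P y) ∧ ContDiffOn ℝ 2 φ Ω ∧
      ∀ y ∈ Ω, u y ≤ φ y := by
  let U : TopologicalSpace.Opens E := ⟨Ω, hΩ⟩
  let t : U → Set ℝ := fun y => {v | u y ≤ v ∧ ((y : E) ∈ closedBall x (r / 2) → v = P y)}
  have ht : ∀ y, Convex ℝ (t y) := by
    intro y a ha b hb α β hα hβ hαβ
    refine ⟨?_, fun hy => ?_⟩
    · have h := (convex_Ici (u y)) ha.1 hb.1 hα hβ hαβ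
      exact h
    · rw [ha.2 hy, hb.2 hy, ← add_smul, hαβ, one_smul]
  have hUc : Continuous (fun y : U => u y) := continuousOn_iff_continuous_domRestrict.1 hu
  have hloc : ∀ y : U, ∃ V ∈ 𝓝 y, ∃ g : U → ℝ, ContMDiffOn 𝓘(ℝ, E) 𝓘(ℝ, ℝ) 2 g V ∧
      ∀ z ∈ V, g z ∈ t z := by
    intro y
    by_cases hy : (y : E) ∈ ball x r
    · refine ⟨{z | (z : E) ∈ ball x r}, ?_, fun z => P z, ?_, fun z hz => ⟨hle z z.2 hz, fun _ => rfl⟩⟩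
      · exact (isOpen_ball.preimage continuous_subtype_val).mem_nhds hy
      · exact (hP.contMDiff.comp contMDiff_subtype_val).contMDiffOn
    · refine ⟨{z | (z : E) ∉ closedBall x (r / 2) ∧ u z < u y + 1}, ?_, fun _ => u y + 1,
        contMDiffOn_const, fun z hz => ⟨hz.2.le, fun h => absurd h hz.1⟩⟩
      refine Filter.inter_mem ?_ ?_
      · refine (isClosed_closedBall.isOpen_compl.preimage continuous_subtype_val).mem_nhds ?_
        exact fun h => hy (closedBall_subset_ball (by linarith) h)
      · exact (isOpen_Iio.preimage hUc).mem_nhds (show u y < u y + 1 by linarith)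
  have : LocallyCompactSpace U := hΩ.locallyCompactSpace
  have : SigmaCompactSpace U := sigmaCompactSpace_of_locallyCompact_secondCountable
  obtain ⟨g, hg⟩ := exists_contMDiffMap_forall_mem_convex_of_local (n := 2) 𝓘(ℝ, E) ht hloc
  have hext : ∀ y : U, Function.extend Subtype.val g 0 (y : E) = g y :=
    fun y => Subtype.val_injective.extend_apply _ _ _
  refine ⟨Function.extend Subtype.val g 0, fun y hy hyr => ?_, fun y hy => ?_, fun y hy => ?_⟩
  · rw [hext ⟨y, hy⟩]
    exact (hg ⟨y, hy⟩).2 (ball_subset_closedBall hyr)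
  · refine ContDiffAt.contDiffWithinAt ?_
    rw [← contMDiffAt_iff_contDiffAt]
    refine (contMDiffAt_subtype_iff (U := U) (x := ⟨y, hy⟩)).1 ?_
    simp only [hext]
    exact g.contMDiff.contMDiffAt
  · rw [hext ⟨y, hy⟩]
    exact (hg ⟨y, hy⟩).1

end TouchingFunction

section InfinityLaplacian

open scoped Topology

variable {n : ℕ}

theorem infLap_congr {φ ψ : EuclideanSpace ℝ (Fin n) → ℝ} {x : EuclideanSpace ℝ (Fin n)}
    (h : φ =ᶠ[𝓝 x] ψ) : infLap φ x = infLap ψ x := by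
  have h1 : gradient (𝕜 := ℝ) φ =ᶠ[𝓝 x] gradient (𝕜 := ℝ) ψ := by
    filter_upwards [h.fderiv (𝕜 := ℝ)] with y hy
    simp only [gradient, hy]
  rw [infLap, infLap, hessianCLM, hessianCLM, h1.fderiv_eq, h1.eq_of_nhds]

/-- The infinity Laplacian of `a + ⟪q, h⟫ + C/2 |h|² - K ⟪e, h⟫²`, `h = y - x`, at `x`. -/
theorem infLap_quadratic (x q e : EuclideanSpace ℝ (Fin n)) (a C K : ℝ) :
    infLap (fun y => a + ⟪q, y - x⟫ + C / 2 * ‖y - x‖ ^ 2 - K * ⟪e, y - x⟫ ^ 2) x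
      = C * ‖q‖ ^ 2 - 2 * K * ⟪q, e⟫ ^ 2 := by
  have hgrad : gradient (fun y : EuclideanSpace ℝ (Fin n) =>
      a + ⟪q, y - x⟫ + C / 2 * ‖y - x‖ ^ 2 - K * ⟪e, y - x⟫ ^ 2)
      = fun y => q + C • (y - x) - (2 * K * ⟪e, y - x⟫) • e := by
    funext y
    refine HasGradientAt.gradient ?_
    rw [hasGradientAt_iff_hasFDerivAt]
    have hid : HasFDerivAt (fun y : EuclideanSpace ℝ (Fin n) => y - x)
      (ContinuousLinearMap.id ℝ _) y := (hasFDerivAt_id y).sub_const x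
    have hin : ∀ v : EuclideanSpace ℝ (Fin n), HasFDerivAt (fun y => ⟪v, y - x⟫)
        (innerSL ℝ v) y := fun v => by
      exact (innerSL ℝ v).hasFDerivAt.comp y hid
    have H := (((hin q).const_add a).add (hid.norm_sq.const_mul (C / 2))).sub
      (((hin e).pow 2).const_mul K)
    refine H.congr_fderiv ?_
    ext v
    simp
    ring
  have hhess : HasFDerivAt (fun y : EuclideanSpace ℝ (Fin n) =>
      q + C • (y - x) - (2 * K * ⟪e, y - x⟫) • e)
      (C • ContinuousLinearMap.id ℝ _ - ((2 * K) • innerSL ℝ e).smulRight e) x := by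
    have hid : HasFDerivAt (fun y : EuclideanSpace ℝ (Fin n) => y - x)
      (ContinuousLinearMap.id ℝ _) x := (hasFDerivAt_id x).sub_const x
    have hin : HasFDerivAt (fun y => ⟪e, y - x⟫) (innerSL ℝ e) x := by
      exact (innerSL ℝ e).hasFDerivAt.comp x hid
    exact ((hid.const_smul C).const_add q).sub ((hin.const_mul (2 * K)).smul_const e)
  rw [infLap, hessianCLM, hgrad, hhess.fderiv]
  simp only [sub_self, smul_zero, inner_zero_right, mul_zero, zero_smul, add_zero, sub_zero]
  simp [inner_sub_left, inner_smul_left, real_inner_comm e q]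
  ring

/-- A viscosity subsolution of `-Δ∞ u = f(x,u)` has at most one proximal supergradient
at each point. -/
theorem eq_of_quadratic_above {Ω : Set (EuclideanSpace ℝ (Fin n))} (hΩ : IsOpen Ω)
    {u : EuclideanSpace ℝ (Fin n) → ℝ} (hu : ContinuousOn u Ω) {b : ℝ}
    {x : EuclideanSpace ℝ (Fin n)} (hx : x ∈ Ω)
    (hsub : ∀ φ : EuclideanSpace ℝ (Fin n) → ℝ, ContDiffOn ℝ 2 φ Ω →
      φ x = u x → (∀ y ∈ Ω, u y ≤ φ y) → -infLap φ x ≤ b)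
    {C : ℝ} {p p' : EuclideanSpace ℝ (Fin n)}
    (hp : ∀ᶠ y in 𝓝 x, u y ≤ u x + ⟪p, y - x⟫ + C / 2 * ‖y - x‖ ^ 2)
    (hp' : ∀ᶠ y in 𝓝 x, u y ≤ u x + ⟪p', y - x⟫ + C / 2 * ‖y - x‖ ^ 2) : p = p' := by
  by_contra hne
  set e := p' - p with he
  have hee : 0 < ⟪e, e⟫ := by
    rw [real_inner_self_eq_norm_sq]
    have : 0 < ‖e‖ := norm_pos_iff.2 (sub_ne_zero.2 (Ne.symm hne))
    positivity
  obtain ⟨t, ht1, ht2, hqe⟩ : ∃ t : ℝ, 1 / 3 ≤ t ∧ t ≤ 2 / 3 ∧ ⟪p + t • e, e⟫ ≠ 0 := by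
    by_contra! H
    have h1 := H (1 / 3) (by norm_num) (by norm_num)
    have h2 := H (2 / 3) (by norm_num) (by norm_num)
    rw [inner_add_left, real_inner_smul_left] at h1 h2
    linarith
  set q := p + t • e with hq
  have hqe2 : 0 < ⟪q, e⟫ ^ 2 := by positivity
  obtain ⟨K, hK0, hK⟩ : ∃ K : ℝ, 0 < K ∧ b + C * ‖q‖ ^ 2 < 2 * K * ⟪q, e⟫ ^ 2 := by
    refine ⟨(|b + C * ‖q‖ ^ 2| + 1) / ⟪q, e⟫ ^ 2, by positivity, ?_⟩
    rw [mul_assoc, div_mul_cancel₀ _ hqe2.ne']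
    linarith [le_abs_self (b + C * ‖q‖ ^ 2), abs_nonneg (b + C * ‖q‖ ^ 2)]
  let P : EuclideanSpace ℝ (Fin n) → ℝ :=
    fun y => u x + ⟪q, y - x⟫ + C / 2 * ‖y - x‖ ^ 2 - K * ⟪e, y - x⟫ ^ 2
  have hP : ContDiff ℝ 2 P := by
    have h1 : ContDiff ℝ 2 (fun y : EuclideanSpace ℝ (Fin n) => y - x) :=
      contDiff_id.sub contDiff_const
    exact ((contDiff_const.add (contDiff_const.inner ℝ h1)).add
      (contDiff_const.mul (h1.norm_sq ℝ))).sub (contDiff_const.mul ((contDiff_const.inner ℝ h1).pow 2))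
  have hsmall : ∀ᶠ y in 𝓝 x, K * |⟪e, y - x⟫| < 1 / 3 := by
    have hcont : Continuous (fun y => K * |⟪e, y - x⟫|) := by fun_prop
    refine (hcont.tendsto x).eventually_lt_const ?_
    simp
  have huP : ∀ᶠ y in 𝓝 x, u y ≤ P y := by
    filter_upwards [hp, hp', hsmall] with y h1 h2 h3
    have h4 : ⟪p', y - x⟫ = ⟪p, y - x⟫ + ⟪e, y - x⟫ := by rw [he, inner_sub_left]; ring
    have h5 : ⟪q, y - x⟫ = ⟪p, y - x⟫ + t * ⟪e, y - x⟫ := by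
      rw [hq, inner_add_left, real_inner_smul_left]
    simp only [P, h5]
    rw [h4] at h2
    have h6 : K * ⟪e, y - x⟫ ^ 2 ≤ 1 / 3 * |⟪e, y - x⟫| := by
      rw [← sq_abs]
      nlinarith [abs_nonneg ⟪e, y - x⟫]
    rcases abs_cases ⟪e, y - x⟫ with ⟨h7, h8⟩ | ⟨h7, h8⟩ <;> rw [h7] at h6 <;> nlinarith
  obtain ⟨r, hr, hball⟩ := Metric.eventually_nhds_iff_ball.1 huP
  obtain ⟨φ, hφP, hφ, hφu⟩ := exists_contDiffOn_eventuallyEq_le hΩ hu hP hr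
    fun y _ hy => hball y hy
  have hEq : φ =ᶠ[𝓝 x] P := by
    filter_upwards [hΩ.mem_nhds hx, ball_mem_nhds x (half_pos hr)] with y hy hy' using hφP y hy hy'
  have hfin := hsub φ hφ (by rw [hEq.eq_of_nhds]; simp [P]) hφu
  rw [infLap_congr hEq, infLap_quadratic] at hfin
  linarith

theorem SemiconcaveWith.convexOn {C : ℝ} {K : Set (EuclideanSpace ℝ (Fin n))}
    {u : EuclideanSpace ℝ (Fin n) → ℝ} (h : SemiconcaveWith C K u) (hK : Convex ℝ K) :
    ConvexOn ℝ K fun y => C / 2 * ‖y‖ ^ 2 - u y := by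
  refine ⟨hK, fun y hy z hz α β hα hβ hαβ => ?_⟩
  obtain rfl : β = 1 - α := by linarith
  have h1 := h y hy z hz α hα (by linarith)
  have h2 : ‖α • y + (1 - α) • z‖ ^ 2
      = α * ‖y‖ ^ 2 + (1 - α) * ‖z‖ ^ 2 - α * (1 - α) * ‖y - z‖ ^ 2 := by
    rw [norm_add_sq_real, norm_sub_sq_real, norm_smul, norm_smul, mul_pow, mul_pow,
      real_inner_smul_left, real_inner_smul_right, Real.norm_eq_abs, Real.norm_eq_abs, sq_abs,
      sq_abs]
    ring
  simp only [smul_eq_mul, h2]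
  linarith

theorem SemiconcaveWith.mono {C : ℝ} {K L : Set (EuclideanSpace ℝ (Fin n))}
    {u : EuclideanSpace ℝ (Fin n) → ℝ} (h : SemiconcaveWith C K u) (hL : L ⊆ K) :
    SemiconcaveWith C L u :=
  fun x hx y hy => h x (hL hx) y (hL hy)

end InfinityLaplacian

/-- A locally semiconcave viscosity solution of `-Δ∞ u = f(x,u)` is
everywhere differentiable, hence of class `C¹`. -/
theorem c1_of_locally_semiconcave (n : ℕ) (Ω : Set (EuclideanSpace ℝ (Fin n)))
    (hΩo : IsOpen Ω) (f : EuclideanSpace ℝ (Fin n) → ℝ → ℝ)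
    (hf : ContinuousOn (fun q : EuclideanSpace ℝ (Fin n) × ℝ => f q.1 q.2) (Ω ×ˢ univ))
    (u : EuclideanSpace ℝ (Fin n) → ℝ) (huc : ContinuousOn u Ω)
    (hsub : ∀ x ∈ Ω, ∀ φ : EuclideanSpace ℝ (Fin n) → ℝ, ContDiffOn ℝ 2 φ Ω →
      φ x = u x → (∀ y ∈ Ω, u y ≤ φ y) → -infLap φ x ≤ f x (u x))
    (hsup : ∀ x ∈ Ω, ∀ φ : EuclideanSpace ℝ (Fin n) → ℝ, ContDiffOn ℝ 2 φ Ω →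
      φ x = u x → (∀ y ∈ Ω, φ y ≤ u y) → f x (u x) ≤ -infLap φ x)
    (hsc : LocallySemiconcaveOn Ω u) :
    (∀ x ∈ Ω, DifferentiableAt ℝ u x) ∧ ContDiffOn ℝ 1 u Ω := by
  have hC1 : ∀ x ∈ Ω, ContDiffAt ℝ 1 u x := by
    intro x hx
    obtain ⟨r, hr, hrΩ⟩ := Metric.nhds_basis_closedBall.mem_iff.1 (hΩo.mem_nhds hx)
    obtain ⟨C, hC⟩ := hsc _ hrΩ (isCompact_closedBall x r) (convex_closedBall x r)
    have hBΩ : ball x r ⊆ Ω := ball_subset_closedBall.trans hrΩ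
    have hconv := (hC.mono ball_subset_closedBall).convexOn (convex_ball x r)
    have hcont : ContinuousOn (fun y => C / 2 * ‖y‖ ^ 2 - u y) (ball x r) :=
      ContinuousOn.sub (by fun_prop) (huc.mono hBΩ)
    have habove : ∀ z ∈ ball x r, ∀ l,
        IsSubgradientOn (fun y => C / 2 * ‖y‖ ^ 2 - u y) (ball x r) z l →
        ∀ᶠ y in nhds z, u y ≤ u z
          + ⟪C • z - (InnerProductSpace.toDual ℝ _).symm l, y - z⟫ + C / 2 * ‖y - z‖ ^ 2 := by
      intro z hz l hl
      filter_upwards [isOpen_ball.mem_nhds hz] with y hy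
      have h1 := hl y hy
      have h2 : ‖y‖ ^ 2 = ‖z‖ ^ 2 + 2 * ⟪z, y - z⟫ + ‖y - z‖ ^ 2 := by
        rw [← norm_add_sq_real, add_sub_cancel]
      rw [inner_sub_left, real_inner_smul_left, InnerProductSpace.toDual_symm_apply]
      simp only [h2] at h1
      linarith
    have huniq : ∀ z ∈ ball x r, ∀ l l',
        IsSubgradientOn (fun y => C / 2 * ‖y‖ ^ 2 - u y) (ball x r) z l →
        IsSubgradientOn (fun y => C / 2 * ‖y‖ ^ 2 - u y) (ball x r) z l' → l = l' := by
      intro z hz l l' hl hl'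
      have h := eq_of_quadratic_above hΩo huc (hBΩ hz) (hsub z (hBΩ hz))
        (habove z hz l hl) (habove z hz l' hl')
      exact (InnerProductSpace.toDual ℝ _).symm.injective (sub_right_injective h)
    have hg := hconv.contDiffAt_one_of_unique_isSubgradientOn isOpen_ball hcont huniq
      (mem_ball_self hr)
    have hq : ContDiffAt ℝ 1 (fun y : EuclideanSpace ℝ (Fin n) => C / 2 * ‖y‖ ^ 2) x :=
      contDiffAt_const.mul (contDiffAt_id.norm_sq ℝ)
    simpa using hq.sub hg
  exact ⟨fun x hx => (hC1 x hx).differentiableAt one_ne_zero,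
    fun x hx => (hC1 x hx).contDiffWithinAt⟩
end

section
/- Let Ω ⊆ ℝ^n be open and let u : Ω → (0,∞) be a positive upper semicontinuous function. Then u is a viscosity subsolution of −Δ∞^N u = 1 in Ω if and only if the function w := −u^{1/2} is a restricted viscosity supersolution of the equation F(w, ∇w, ∇²w) = 0 in Ω, where F(w,p,A) := −⟨Ap,p⟩ − (1/w)(|p|⁴ + (1/2)|p|²). -/
open Set Metric Filter
open scoped RealInnerProductSpace

open Topology in
lemma gradient_eventuallyEq_of_eventuallyEq_sq {n : ℕ} {φ ψ : EuclideanSpace ℝ (Fin n) → ℝ}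
    {x : EuclideanSpace ℝ (Fin n)} (hψ : ContDiffAt ℝ 2 ψ x)
    (h : φ =ᶠ[𝓝 x] fun y => ψ y ^ 2) :
    gradient φ =ᶠ[𝓝 x] fun y => (2 * ψ y) • gradient ψ y := by
  filter_upwards [h.eventuallyEq_nhds, hψ.eventually (by simp)] with y hy hd
  have hd' : DifferentiableAt ℝ ψ y := hd.differentiableAt (by simp)
  simp only [gradient, ← map_smul]
  rw [hy.fderiv_eq, fderiv_fun_pow 2 hd']
  simp

open Topology in
lemma hessianCLM_apply_of_eventuallyEq_sq {n : ℕ} {φ ψ : EuclideanSpace ℝ (Fin n) → ℝ}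
    {x : EuclideanSpace ℝ (Fin n)} (hψ : ContDiffAt ℝ 2 ψ x)
    (h : φ =ᶠ[𝓝 x] fun y => ψ y ^ 2) (v : EuclideanSpace ℝ (Fin n)) :
    hessianCLM φ x v =
      (2 * ψ x) • hessianCLM ψ x v + (2 * ⟪gradient ψ x, v⟫) • gradient ψ x := by
  have hd : DifferentiableAt ℝ ψ x := hψ.differentiableAt (by simp)
  have hg : DifferentiableAt ℝ (gradient ψ) x := by
    have h1 : DifferentiableAt ℝ (fderiv ℝ ψ) x :=
      (hψ.fderiv_right (m := 1) (by norm_num)).differentiableAt (by simp)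
    exact (InnerProductSpace.toDual ℝ
      (EuclideanSpace ℝ (Fin n))).symm.toContinuousLinearEquiv.differentiableAt.comp x h1
  rw [hessianCLM, (gradient_eventuallyEq_of_eventuallyEq_sq hψ h).fderiv_eq,
    fderiv_fun_smul (hd.const_mul 2) hg, fderiv_const_mul hd]
  simp [hessianCLM, gradient]

lemma lamMax_eq_mul_lamMin {n : ℕ} {A B : EuclideanSpace ℝ (Fin n) →L[ℝ] EuclideanSpace ℝ (Fin n)}
    {c : ℝ} (hc : c ≤ 0) (h : ∀ v, B v = c • A v) : lamMax B = c * lamMin A := by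
  rw [lamMax, lamMin, ← smul_eq_mul, ← Real.sSup_smul_of_nonpos hc, ← Set.image_smul,
    Set.image_image]
  simp [h, inner_smul_left]

open Topology in
/-- The substitution `φ = ψ²` with `ψ x < 0` exchanges the two test-function conditions. -/
lemma subsol_test_iff_supersol_test {n : ℕ} {φ ψ : EuclideanSpace ℝ (Fin n) → ℝ}
    {x : EuclideanSpace ℝ (Fin n)} (hψ : ContDiffAt ℝ 2 ψ x) (hneg : ψ x < 0)
    (h : φ =ᶠ[𝓝 x] fun y => ψ y ^ 2) :
    ((gradient φ x ≠ 0 → -infLap φ x ≤ 1 * ‖gradient φ x‖ ^ 2) ∧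
      (gradient φ x = 0 → -lamMax (hessianCLM φ x) ≤ 1)) ↔
    (0 ≤ Ffun (ψ x) (gradient ψ x) (hessianCLM ψ x) ∧
      (gradient ψ x = 0 → lamMin (hessianCLM ψ x) ≤ -1 / (2 * ψ x))) := by
  have hgrad : gradient φ x = (2 * ψ x) • gradient ψ x :=
    (gradient_eventuallyEq_of_eventuallyEq_sq hψ h).self_of_nhds
  have hhess := hessianCLM_apply_of_eventuallyEq_sq hψ h
  by_cases hp : gradient ψ x = 0
  · have hlam : lamMax (hessianCLM φ x) = 2 * ψ x * lamMin (hessianCLM ψ x) :=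
      lamMax_eq_mul_lamMin (by linarith) fun v => by simp [hhess v, hp]
    have hiff : -(2 * ψ x * lamMin (hessianCLM ψ x)) ≤ 1 ↔
        lamMin (hessianCLM ψ x) ≤ -1 / (2 * ψ x) := by
      rw [le_div_iff_of_neg (by linarith)]
      constructor <;> intro h <;> linarith
    simp [hgrad, hp, hlam, hiff, Ffun]
  · have hp' : gradient φ x ≠ 0 := by simp [hgrad, hp, hneg.ne]
    have hF : -(4 * ψ x ^ 2) * (2 * ψ x) * Ffun (ψ x) (gradient ψ x) (hessianCLM ψ x) =
        ‖gradient φ x‖ ^ 2 + infLap φ x := by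
      rw [infLap, hhess, hgrad, Ffun, norm_smul, mul_pow, Real.norm_eq_abs, sq_abs]
      simp only [map_smul, inner_add_left, inner_smul_left, inner_smul_right,
        real_inner_self_eq_norm_sq, conj_trivial]
      field_simp [hneg.ne]
      ring
    have hc : 0 < -(4 * ψ x ^ 2) * (2 * ψ x) := by
      have := mul_pos (pow_pos (neg_pos.2 hneg) 2) (neg_pos.2 hneg)
      nlinarith
    simp only [hp, hp', ne_eq, not_false_eq_true, forall_const, IsEmpty.forall_iff, and_true,
      one_mul]
    rw [← mul_nonneg_iff_of_pos_left hc, hF]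
    constructor <;> intro h <;> linarith

/-- A positive upper semicontinuous `u` is a viscosity subsolution of
`-Δ∞^N u = 1` iff `w = -u^{1/2}` is a restricted viscosity supersolution of
`F(w,∇w,∇²w) = 0`. -/
theorem subsol_iff_restricted_supersol (n : ℕ) (Ω : Set (EuclideanSpace ℝ (Fin n)))
    (hΩo : IsOpen Ω) (u : EuclideanSpace ℝ (Fin n) → ℝ)
    (hpos : ∀ x ∈ Ω, 0 < u x) (husc : UpperSemicontinuousOn u Ω) :
    IsNSubsol Ω (fun _ => 1) u ↔
      IsRestrictedSupersol Ω (fun x => -Real.sqrt (u x)) := by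
  constructor
  · rintro ⟨-, hu⟩
    refine ⟨Continuous.comp_upperSemicontinuousOn_antitone (g := fun t => -Real.sqrt t)
      (by fun_prop) husc fun a b hab => neg_le_neg (Real.sqrt_le_sqrt hab), ?_⟩
    intro x hx ψ hψ hψx hle
    have hux := Real.sqrt_pos.2 (hpos x hx)
    have key := (subsol_test_iff_supersol_test (φ := fun y => ψ y ^ 2)
      (hψ.contDiffAt (hΩo.mem_nhds hx)) (by linarith) (.refl _ _)).1
    rw [hψx] at key
    refine key (hu x hx _ (hψ.pow 2) ?_ fun y hy => ?_)
    · simp [hψx, Real.sq_sqrt (hpos x hx).le]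
    · have := hle y hy
      rw [← Real.sq_sqrt (hpos y hy).le, ← neg_sq (ψ y)]
      exact pow_le_pow_left₀ (Real.sqrt_nonneg _) (by linarith) 2
  · rintro ⟨-, hw⟩
    refine ⟨husc, fun x hx φ hφ hφx hle => ?_⟩
    have hφpos : ∀ y ∈ Ω, 0 < φ y := fun y hy => (hpos y hy).trans_le (hle y hy)
    have hψ : ContDiffOn ℝ 2 (fun y => -Real.sqrt (φ y)) Ω :=
      (hφ.sqrt fun y hy => (hφpos y hy).ne').neg
    refine (subsol_test_iff_supersol_test (hψ.contDiffAt (hΩo.mem_nhds hx))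
      (neg_neg_of_pos (Real.sqrt_pos.2 (hφpos x hx))) ?_).2 ?_
    · filter_upwards [hΩo.mem_nhds hx] with y hy
      rw [neg_sq, Real.sq_sqrt (hφpos y hy).le]
    · have key := hw x hx _ hψ (by simp [hφx]) fun y hy =>
        neg_le_neg (Real.sqrt_le_sqrt (hle y hy))
      simpa only [hφx] using key
end

section
/- Let Ω ⊆ ℝ^n be open and let u : Ω → (0,∞) be a positive lower semicontinuous function. Then u is a viscosity supersolution of −Δ∞^N u = 1 in Ω if and only if the function w := −u^{1/2} is a restricted viscosity subsolution of the equation F(w, ∇w, ∇²w) = 0 in Ω, where F(w,p,A) := −⟨Ap,p⟩ − (1/w)(|p|⁴ + (1/2)|p|²). -/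
open Set Metric Filter
open scoped RealInnerProductSpace

section ChainRule

variable {n : ℕ} {Ω : Set (EuclideanSpace ℝ (Fin n))} {φ : EuclideanSpace ℝ (Fin n) → ℝ}
  {x : EuclideanSpace ℝ (Fin n)} {g g' : ℝ → ℝ} {c : ℝ}

lemma gradient_comp_real (hφ : DifferentiableAt ℝ φ x) (hg : HasDerivAt g c (φ x)) :
    gradient (fun y => g (φ y)) x = c • gradient φ x := by
  have h : HasFDerivAt (fun y => g (φ y)) (c • fderiv ℝ φ x) x :=
    hg.comp_hasFDerivAt x hφ.hasFDerivAt
  simp [gradient, h.fderiv]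

lemma differentiableAt_gradient_of_contDiffOn (hΩ : IsOpen Ω) (hφ : ContDiffOn ℝ 2 φ Ω)
    (hx : x ∈ Ω) : DifferentiableAt ℝ (gradient φ) x := by
  have h : DifferentiableAt ℝ (fderiv ℝ φ) x :=
    ((hφ.contDiffAt (hΩ.mem_nhds hx)).fderiv_right (m := 1) (by norm_num)).differentiableAt
      (by norm_num)
  exact (InnerProductSpace.toDual ℝ
    (EuclideanSpace ℝ (Fin n))).symm.toContinuousLinearEquiv.differentiableAt.comp x h

lemma hessianCLM_comp_real (hΩ : IsOpen Ω) (hφ : ContDiffOn ℝ 2 φ Ω) (hx : x ∈ Ω)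
    (hg : ∀ t, HasDerivAt g (g' t) t) (hg' : HasDerivAt g' c (φ x))
    (v : EuclideanSpace ℝ (Fin n)) :
    hessianCLM (fun y => g (φ y)) x v =
      g' (φ x) • hessianCLM φ x v + (c * ⟪gradient φ x, v⟫) • gradient φ x := by
  have hd : ∀ y ∈ Ω, DifferentiableAt ℝ φ y := fun y hy =>
    (hφ.contDiffAt (hΩ.mem_nhds hy)).differentiableAt (by norm_num)
  have hev : gradient (fun y => g (φ y)) =ᶠ[nhds x] fun y => g' (φ y) • gradient φ y := by
    filter_upwards [hΩ.mem_nhds hx] with y hy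
    exact gradient_comp_real (hd y hy) (hg _)
  have h1 : HasFDerivAt (fun y => g' (φ y)) (c • fderiv ℝ φ x) x :=
    hg'.comp_hasFDerivAt x (hd x hx).hasFDerivAt
  have h2 := (differentiableAt_gradient_of_contDiffOn hΩ hφ hx).hasFDerivAt
  have h3 : ⟪gradient φ x, v⟫ = fderiv ℝ φ x v := by simp [gradient]
  have h4 : HasFDerivAt (fun y => g' (φ y) • gradient φ y) _ x := h1.smul h2
  rw [hessianCLM, hev.fderiv_eq, h4.fderiv, h3]
  simp [hessianCLM]

end ChainRule

lemma lamMin_smul_of_nonpos {n : ℕ} {c : ℝ} (hc : c ≤ 0)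
    (A : EuclideanSpace ℝ (Fin n) →L[ℝ] EuclideanSpace ℝ (Fin n)) :
    lamMin (c • A) = c * lamMax A := by
  rw [lamMin, lamMax, ← smul_eq_mul, ← Real.sInf_smul_of_nonpos hc, ← Set.image_smul,
    Set.image_image]
  simp [inner_smul_left]

lemma lamMax_smul_of_nonpos {n : ℕ} {c : ℝ} (hc : c ≤ 0)
    (A : EuclideanSpace ℝ (Fin n) →L[ℝ] EuclideanSpace ℝ (Fin n)) :
    lamMax (c • A) = c * lamMin A := by
  rw [lamMin, lamMax, ← smul_eq_mul, ← Real.sSup_smul_of_nonpos hc, ← Set.image_smul,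
    Set.image_image]
  simp [inner_smul_left]

/-- A polynomial with the same 2-jet as `t ↦ t ^ 2` at `-a`, lying below `t ^ 2` everywhere and
nonpositive for `0 ≤ t`. -/
noncomputable def sqMinorant (a t : ℝ) : ℝ := t ^ 2 - (t + a) ^ 4 / a ^ 2

lemma contDiff_sqMinorant (a : ℝ) : ContDiff ℝ 2 (sqMinorant a) := by
  unfold sqMinorant; fun_prop

lemma sqMinorant_neg_self (a : ℝ) : sqMinorant a (-a) = a ^ 2 := by simp [sqMinorant]

lemma hasDerivAt_sqMinorant (a t : ℝ) :
    HasDerivAt (sqMinorant a) (2 * t - 4 * (t + a) ^ 3 / a ^ 2) t := by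
  have h := ((hasDerivAt_id t).pow 2).sub
    ((((hasDerivAt_id t).add_const a).pow 4).div_const (a ^ 2))
  refine h.congr_deriv ?_
  simp

lemma hasDerivAt_deriv_sqMinorant (a : ℝ) :
    HasDerivAt (fun t => 2 * t - 4 * (t + a) ^ 3 / a ^ 2) 2 (-a) := by
  have h := ((hasDerivAt_id (-a)).const_mul 2).sub
    (((((hasDerivAt_id (-a)).add_const a).pow 3).const_mul 4).div_const (a ^ 2))
  refine h.congr_deriv ?_
  simp

lemma sqMinorant_le {a t r : ℝ} (ha : 0 < a) (hr : 0 ≤ r) (h : -r ≤ t) :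
    sqMinorant a t ≤ r ^ 2 := by
  unfold sqMinorant
  rcases le_total t 0 with ht | ht
  · have : 0 ≤ (t + a) ^ 4 / a ^ 2 := by positivity
    nlinarith
  · have : t ^ 2 ≤ (t + a) ^ 4 / a ^ 2 := by
      rw [le_div_iff₀ (by positivity)]
      have h1 : t * a ≤ (t + a) ^ 2 := by nlinarith
      have h2 : 0 ≤ t * a := by positivity
      nlinarith
    nlinarith [sq_nonneg r]

/-- A polynomial with the same 2-jet as `s ↦ -√s` at `a ^ 2`, lying above `-√s` for `0 ≤ s` and
nonnegative for `s ≤ 0`. -/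
noncomputable def negSqrtMajorant (a s : ℝ) : ℝ :=
  a * (-1 - (s / a ^ 2 - 1) / 2 + (s / a ^ 2 - 1) ^ 2 / 8 - (s / a ^ 2 - 1) ^ 3 / 16
    + (s / a ^ 2 - 1) ^ 4)

lemma contDiff_negSqrtMajorant (a : ℝ) : ContDiff ℝ 2 (negSqrtMajorant a) := by
  unfold negSqrtMajorant; fun_prop

lemma negSqrtMajorant_sq {a : ℝ} (ha : a ≠ 0) : negSqrtMajorant a (a ^ 2) = -a := by
  simp [negSqrtMajorant, ha]

/-- The derivative of `negSqrtMajorant a`. -/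
noncomputable def negSqrtMajorantDeriv (a s : ℝ) : ℝ :=
  1 / a * (-1 / 2 + (s / a ^ 2 - 1) / 4 - 3 * (s / a ^ 2 - 1) ^ 2 / 16 + 4 * (s / a ^ 2 - 1) ^ 3)

lemma hasDerivAt_negSqrtMajorant {a : ℝ} (ha : a ≠ 0) (s : ℝ) :
    HasDerivAt (negSqrtMajorant a) (negSqrtMajorantDeriv a s) s := by
  have hy := ((hasDerivAt_id s).div_const (a ^ 2)).sub_const 1
  have h := (((((hy.div_const 2).const_sub (-1)).add ((hy.pow 2).div_const 8)).sub
    ((hy.pow 3).div_const 16)).add (hy.pow 4)).const_mul a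
  refine h.congr_deriv ?_
  simp [negSqrtMajorantDeriv]
  field_simp
  ring

lemma hasDerivAt_negSqrtMajorantDeriv {a : ℝ} (ha : a ≠ 0) :
    HasDerivAt (negSqrtMajorantDeriv a) (1 / (4 * a ^ 3)) (a ^ 2) := by
  have hy := ((hasDerivAt_id (a ^ 2)).div_const (a ^ 2)).sub_const 1
  have h := ((((hy.div_const 4).const_add (-1 / 2)).sub
    (((hy.pow 2).const_mul 3).div_const 16)).add ((hy.pow 3).const_mul 4)).const_mul (1 / a)
  refine h.congr_deriv ?_
  simp [ha]
  field_simp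

lemma negSqrtMajorant_ge {a s r : ℝ} (ha : 0 < a) (hr : 0 ≤ r) (h : s ≤ r ^ 2) :
    -r ≤ negSqrtMajorant a s := by
  rcases le_total s 0 with hs | hs
  · refine (neg_nonpos.2 hr).trans (mul_nonneg ha.le ?_)
    obtain ⟨z, hz⟩ : ∃ z, s / a ^ 2 - 1 = -1 - z := ⟨-(s / a ^ 2), by ring⟩
    have hz0 : 0 ≤ z := by
      have := div_nonpos_of_nonpos_of_nonneg hs (sq_nonneg a)
      linarith
    rw [hz]
    have : 0 ≤ z ^ 2 := by positivity
    have : 0 ≤ z ^ 3 := by positivity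
    have : 0 ≤ z ^ 4 := by positivity
    nlinarith
  · obtain ⟨q, hq0, rfl⟩ : ∃ q, 0 ≤ q ∧ s = (a * q) ^ 2 :=
      ⟨√s / a, by positivity, by field_simp; exact (Real.sq_sqrt hs).symm⟩
    have hqr : a * q ≤ r := abs_le_of_sq_le_sq' h hr |>.2
    have hdiv : (a * q) ^ 2 / a ^ 2 = q ^ 2 := by field_simp
    have key : negSqrtMajorant a ((a * q) ^ 2) + a * q =
        a * ((q - 1) ^ 4 * ((q + 1) ^ 4 - (q ^ 2 + 4 * q + 5) / 16)) := by
      rw [negSqrtMajorant, hdiv]; ring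
    have : 0 ≤ (q + 1) ^ 4 - (q ^ 2 + 4 * q + 5) / 16 := by
      have : 0 ≤ q ^ 2 := by positivity
      have : 0 ≤ q ^ 3 := by positivity
      have : 0 ≤ q ^ 4 := by positivity
      nlinarith
    have : 0 ≤ negSqrtMajorant a ((a * q) ^ 2) + a * q := by
      rw [key]; positivity
    linarith

/-- A positive lower semicontinuous `u` is a viscosity supersolution of
`-Δ∞^N u = 1` iff `w = -u^{1/2}` is a restricted viscosity subsolution of
`F(w,∇w,∇²w) = 0`. -/
theorem supersol_iff_restricted_subsol (n : ℕ) (Ω : Set (EuclideanSpace ℝ (Fin n)))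
    (hΩo : IsOpen Ω) (u : EuclideanSpace ℝ (Fin n) → ℝ)
    (hpos : ∀ x ∈ Ω, 0 < u x) (hlsc : LowerSemicontinuousOn u Ω) :
    IsNSupersol Ω (fun _ => 1) u ↔
      IsRestrictedSubsol Ω (fun x => -Real.sqrt (u x)) := by
  constructor
  · rintro ⟨-, hsup⟩
    refine ⟨(Real.continuous_sqrt.neg).comp_lowerSemicontinuousOn_antitone hlsc
      (fun _ _ h => neg_le_neg (Real.sqrt_le_sqrt h)), fun x hx ψ hψ hψx hle => ?_⟩
    have ha : 0 < √(u x) := Real.sqrt_pos.2 (hpos x hx)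
    have hsq : √(u x) ^ 2 = u x := Real.sq_sqrt (hpos x hx).le
    beta_reduce at *
    generalize √(u x) = a at *
    obtain ⟨h1, h2⟩ := hsup x hx (fun y => sqMinorant a (ψ y))
      ((contDiff_sqMinorant a).comp_contDiffOn hψ)
      (by simp only [hψx, sqMinorant_neg_self, hsq])
      (fun y hy => (sqMinorant_le ha (Real.sqrt_nonneg _) (hle y hy)).trans_eq
        (Real.sq_sqrt (hpos y hy).le))
    have hgrad : gradient (fun y => sqMinorant a (ψ y)) x = (-(2 * a)) • gradient ψ x := by
      rw [gradient_comp_real ((hψ.contDiffAt (hΩo.mem_nhds hx)).differentiableAt (by norm_num))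
        (hasDerivAt_sqMinorant a _), hψx]
      simp
    have hhess : ∀ v, hessianCLM (fun y => sqMinorant a (ψ y)) x v =
        (-(2 * a)) • hessianCLM ψ x v + (2 * ⟪gradient ψ x, v⟫) • gradient ψ x := by
      intro v
      rw [hessianCLM_comp_real hΩo hψ hx (hasDerivAt_sqMinorant a)
        (by rw [hψx]; exact hasDerivAt_deriv_sqMinorant a), hψx]
      simp
    rw [infLap, hhess, hgrad] at h1
    rw [hgrad] at h2
    by_cases hp : gradient ψ x = 0
    · refine ⟨by simp [Ffun, hp], fun _ => ?_⟩
      have hH : hessianCLM (fun y => sqMinorant a (ψ y)) x = (-(2 * a)) • hessianCLM ψ x := by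
        ext1 v; simp [hhess, hp]
      have h3 := h2 (by simp [hp])
      rw [hH, lamMin_smul_of_nonpos (by linarith)] at h3
      have h4 : -1 / (2 * -a) = 1 / (2 * a) := by field_simp
      rw [h4, div_le_iff₀ (by positivity)]
      linarith
    · refine ⟨?_, fun h => absurd h hp⟩
      have h3 := h1 (smul_ne_zero (by linarith) hp)
      simp only [norm_smul, map_smul, inner_add_left, inner_smul_left, inner_smul_right,
        real_inner_self_eq_norm_sq, Real.norm_eq_abs, mul_pow, sq_abs, conj_trivial] at h3
      unfold Ffun
      generalize ⟪hessianCLM ψ x (gradient ψ x), gradient ψ x⟫ = b at *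
      generalize ‖gradient ψ x‖ = q at *
      have h4 : 0 ≤ 8 * a ^ 3 * (b - 1 / a * (q ^ 4 + 1 / 2 * q ^ 2)) := by
        field_simp
        nlinarith
      have h5 := nonneg_of_mul_nonneg_right h4 (by positivity)
      rw [one_div_neg_eq_neg_one_div]
      linarith
  · rintro ⟨-, hsub⟩
    refine ⟨hlsc, fun x hx φ hφ hφx hle => ?_⟩
    have ha : 0 < √(u x) := Real.sqrt_pos.2 (hpos x hx)
    have hsq : √(u x) ^ 2 = u x := Real.sq_sqrt (hpos x hx).le
    have hsub' := hsub x hx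
    beta_reduce at *
    generalize √(u x) = a at *
    obtain ⟨h1, h2⟩ := hsub' (fun y => negSqrtMajorant a (φ y))
      ((contDiff_negSqrtMajorant a).comp_contDiffOn hφ)
      (by simp only [hφx, ← hsq, negSqrtMajorant_sq ha.ne'])
      (fun y hy => negSqrtMajorant_ge ha (Real.sqrt_nonneg _)
        ((hle y hy).trans_eq (Real.sq_sqrt (hpos y hy).le).symm))
    have hφa : φ x = a ^ 2 := hφx.trans hsq.symm
    have hder : negSqrtMajorantDeriv a (a ^ 2) = -(1 / (2 * a)) := by
      simp [negSqrtMajorantDeriv, ha.ne']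
      field_simp
    have hgrad : gradient (fun y => negSqrtMajorant a (φ y)) x =
        (-(1 / (2 * a))) • gradient φ x := by
      rw [gradient_comp_real ((hφ.contDiffAt (hΩo.mem_nhds hx)).differentiableAt (by norm_num))
        (hasDerivAt_negSqrtMajorant ha.ne' _), hφa, hder]
    have hhess : ∀ v, hessianCLM (fun y => negSqrtMajorant a (φ y)) x v =
        (-(1 / (2 * a))) • hessianCLM φ x v
          + (1 / (4 * a ^ 3) * ⟪gradient φ x, v⟫) • gradient φ x := by
      intro v
      rw [hessianCLM_comp_real hΩo hφ hx (hasDerivAt_negSqrtMajorant ha.ne')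
        (by rw [hφa]; exact hasDerivAt_negSqrtMajorantDeriv ha.ne'), hφa, hder]
    rw [Ffun, hhess, hgrad] at h1
    rw [hgrad] at h2
    refine ⟨fun _ => ?_, fun hp => ?_⟩
    · simp only [norm_smul, map_smul, inner_add_left, inner_smul_left, inner_smul_right,
        real_inner_self_eq_norm_sq, Real.norm_eq_abs, abs_neg, conj_trivial,
        abs_of_pos (one_div_pos.2 (mul_pos two_pos ha))] at h1
      unfold infLap
      generalize ⟪hessianCLM φ x (gradient φ x), gradient φ x⟫ = b at *
      generalize ‖gradient φ x‖ = q at *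
      have h3 := mul_le_mul_of_nonneg_left h1 (by positivity : 0 ≤ 8 * a ^ 3)
      field_simp at h3
      ring_nf at h3
      have h4 : a ^ 2 * (b + q ^ 2) ≤ 0 := by linarith
      have h5 := nonpos_of_mul_nonpos_right h4 (by positivity)
      linarith
    · have hH : hessianCLM (fun y => negSqrtMajorant a (φ y)) x =
          (-(1 / (2 * a))) • hessianCLM φ x := by
        ext1 v; simp [hhess, hp]
      have hc : 0 < 1 / (2 * a) := by positivity
      have h3 := h2 (by simp [hp])
      rw [hH, lamMax_smul_of_nonpos (by linarith)] at h3
      have h4 : -1 / (2 * -a) = 1 / (2 * a) := by field_simp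
      rw [h4] at h3
      exact le_of_mul_le_mul_left (by linarith) hc
end

section
/- Let Ω ⊂ ℝ^n be an open bounded convex set satisfying an interior sphere condition (for every z ∈ ∂Ω there exists a ball B_R(y) ⊆ Ω with z ∈ ∂B_R(y)). Let u ∈ C(cl Ω) be a viscosity solution of the Dirichlet problem −Δ∞^N u = 1 in Ω, u = 0 on ∂Ω, and set w := −u^{1/2} on cl Ω. Let w_** denote the largest convex function on cl Ω lying below w. Fix x ∈ Ω and suppose x₁, …, x_k ∈ cl Ω and λ₁, …, λ_k > 0 with Σᵢ λᵢ = 1 satisfy x = Σᵢ λᵢ xᵢ and w_**(x) = Σᵢ λᵢ w(xᵢ). Then x₁, …, x_k ∈ Ω. -/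
open Set Metric Filter
open scoped RealInnerProductSpace

/-- The gradient of a downward paraboloid. -/
theorem gradient_const_sub_mul_norm_sub_sq {n : ℕ} (m c : ℝ) (y : EuclideanSpace ℝ (Fin n)) :
    gradient (fun x => m - c * ‖x - y‖ ^ 2) = fun x => (-(2 * c)) • (x - y) := by
  funext x
  apply HasGradientAt.gradient
  rw [hasGradientAt_iff_hasFDerivAt]
  have h := (((hasFDerivAt_id x).sub_const y).norm_sq.const_mul c).const_sub m
  refine h.congr_fderiv ?_
  ext v
  simp
  ring

/-- The Hessian of a downward paraboloid. -/
theorem hessianCLM_const_sub_mul_norm_sub_sq {n : ℕ} (m c : ℝ)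
    (x y : EuclideanSpace ℝ (Fin n)) :
    hessianCLM (fun x => m - c * ‖x - y‖ ^ 2) x = (-(2 * c)) • ContinuousLinearMap.id ℝ _ := by
  rw [hessianCLM, gradient_const_sub_mul_norm_sub_sq]
  exact (((hasFDerivAt_id x).sub_const y).const_smul (-(2 * c))).fderiv

/-- A supersolution of `-Δ∞^N u = 1` cannot be touched from below by a paraboloid of
opening less than `1`. -/
theorem IsNSupersol.not_touched_by_paraboloid {n : ℕ} {Ω : Set (EuclideanSpace ℝ (Fin n))}
    {u : EuclideanSpace ℝ (Fin n) → ℝ} (hu : IsNSupersol Ω (fun _ => 1) u)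
    {c : ℝ} (hc0 : 0 ≤ c) (hc : 2 * c < 1) (m : ℝ) (y : EuclideanSpace ℝ (Fin n))
    {x₀ : EuclideanSpace ℝ (Fin n)} (hx₀ : x₀ ∈ Ω) (heq : m - c * ‖x₀ - y‖ ^ 2 = u x₀) :
    ¬ ∀ x ∈ Ω, m - c * ‖x - y‖ ^ 2 ≤ u x := by
  intro hle
  have hsmooth : ContDiff ℝ 2 (fun x : EuclideanSpace ℝ (Fin n) => m - c * ‖x - y‖ ^ 2) :=
    contDiff_const.sub (contDiff_const.mul ((contDiff_id.sub contDiff_const).norm_sq ℝ))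
  obtain ⟨h₁, h₂⟩ := hu.2 x₀ hx₀ _ hsmooth.contDiffOn heq hle
  simp only [infLap, hessianCLM_const_sub_mul_norm_sub_sq] at h₁ h₂
  by_cases hg : gradient (fun x => m - c * ‖x - y‖ ^ 2) x₀ = 0
  · have hmin : -(2 * c) ≤ lamMin ((-(2 * c)) •
        ContinuousLinearMap.id ℝ (EuclideanSpace ℝ (Fin n))) := by
      apply Real.le_sInf _ (by linarith)
      rintro _ ⟨v, hv, rfl⟩
      have hv : ‖v‖ = 1 := hv
      simp [inner_smul_left, hv]
    linarith [h₂ hg]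
  · have h := h₁ hg
    have hpos : 0 < ‖gradient (fun x => m - c * ‖x - y‖ ^ 2) x₀‖ ^ 2 := by positivity
    simp only [smul_apply, ContinuousLinearMap.id_apply,
      real_inner_smul_left, real_inner_self_eq_norm_sq] at h
    nlinarith

/-- Comparison of the Dirichlet solution with a paraboloid vanishing on the boundary of a ball
contained in the domain. -/
theorem IsDirichletSol.paraboloid_le {n : ℕ} {Ω : Set (EuclideanSpace ℝ (Fin n))}
    (hΩo : IsOpen Ω) (hΩb : Bornology.IsBounded Ω) {u : EuclideanSpace ℝ (Fin n) → ℝ}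
    (hu : IsDirichletSol Ω u) {y : EuclideanSpace ℝ (Fin n)} {R : ℝ} (hR : 0 ≤ R)
    (hball : ball y R ⊆ Ω) {x : EuclideanSpace ℝ (Fin n)} (hx : x ∈ closure Ω) :
    (R ^ 2 - ‖x - y‖ ^ 2) / 4 ≤ u x := by
  obtain ⟨hcont, hbdry, -, hsuper⟩ := hu
  obtain ⟨x₀, hx₀, hmin⟩ := hΩb.isCompact_closure.exists_isMinOn ⟨x, hx⟩
    (hcont.sub (f := u) (g := fun x => (R ^ 2 - ‖x - y‖ ^ 2) / 4) (by fun_prop))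
  have hmin' : ∀ z ∈ closure Ω,
      u x₀ - (R ^ 2 - ‖x₀ - y‖ ^ 2) / 4 ≤ u z - (R ^ 2 - ‖z - y‖ ^ 2) / 4 :=
    fun z hz => hmin hz
  have hx₀Ω : x₀ ∉ Ω := fun hmem =>
    hsuper.not_touched_by_paraboloid (c := 1 / 4) (by norm_num) (by norm_num)
      (u x₀ + 1 / 4 * ‖x₀ - y‖ ^ 2) y hmem (by ring)
      fun z hz => by linarith [hmin' z (subset_closure hz)]
  have hu₀ : u x₀ = 0 := hbdry x₀ (hΩo.frontier_eq ▸ ⟨hx₀, hx₀Ω⟩)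
  have hR₀ : R ≤ ‖x₀ - y‖ := by
    by_contra! hlt
    exact hx₀Ω (hball (mem_ball_iff_norm.2 hlt))
  have hsq : R ^ 2 ≤ ‖x₀ - y‖ ^ 2 := by gcongr
  linarith [hmin' x hx]

/-- A convex function decreases at most linearly from an interior point along a direction. -/
theorem ConvexOn.exists_sub_mul_le {E : Type*} [NormedAddCommGroup E] [NormedSpace ℝ E]
    {s : Set E} {f : E → ℝ} (hf : ConvexOn ℝ s f) {x : E} (hx : s ∈ nhds x) (v : E) :
    ∃ L : ℝ, ∀ a : ℝ, 0 ≤ a → x + a • v ∈ s → f x - L * a ≤ f (x + a • v) := by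
  have hlim : Tendsto (fun b : ℝ => x - b • v) (nhdsWithin 0 (Ioi 0)) (nhds x) := by
    have h : Continuous fun b : ℝ => x - b • v := by fun_prop
    simpa using (h.tendsto 0).mono_left nhdsWithin_le_nhds
  obtain ⟨b, hbs, hb⟩ := ((hlim.eventually_mem hx).and self_mem_nhdsWithin).exists
  have hb : 0 < b := hb
  refine ⟨(f (x - b • v) - f x) / b, fun a ha has => ?_⟩
  have hab : 0 < a + b := by linarith
  have ha' : 0 ≤ a / (a + b) := by positivity
  have hb' : 0 ≤ b / (a + b) := by positivity
  have h := hf.2 hbs has ha' hb' (by field_simp)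
  have hpt : (a / (a + b)) • (x - b • v) + (b / (a + b)) • (x + a • v) = x := by
    match_scalars <;> field_simp
    ring
  rw [hpt, smul_eq_mul, smul_eq_mul] at h
  field_simp at h ⊢
  linarith

/-- (Lemma on the convex envelope) If `Ω` satisfies an interior sphere
condition and `w = -u^{1/2}` with `u` the solution of the Dirichlet problem, then in any
representation of the convex envelope `w_**` at an interior point as a convex combination
of values of `w`, all the points of the combination are interior. -/
theorem convex_envelope_contact_points_interior (n : ℕ)
    (Ω : Set (EuclideanSpace ℝ (Fin n)))
    (hΩo : IsOpen Ω) (hΩb : Bornology.IsBounded Ω) (hΩc : Convex ℝ Ω)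
    (hsphere : InteriorSphere Ω)
    (u : EuclideanSpace ℝ (Fin n) → ℝ) (hu : IsDirichletSol Ω u)
    (w : EuclideanSpace ℝ (Fin n) → ℝ) (hw : w = fun x => -Real.sqrt (u x))
    (wss : EuclideanSpace ℝ (Fin n) → ℝ)
    (hconv : ConvexOn ℝ (closure Ω) wss)
    (hle : ∀ y ∈ closure Ω, wss y ≤ w y)
    (hmax : ∀ g : EuclideanSpace ℝ (Fin n) → ℝ, ConvexOn ℝ (closure Ω) g →
      (∀ y ∈ closure Ω, g y ≤ w y) → ∀ y ∈ closure Ω, g y ≤ wss y)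
    (x : EuclideanSpace ℝ (Fin n)) (hx : x ∈ Ω)
    (k : ℕ) (xi : Fin k → EuclideanSpace ℝ (Fin n)) (hxi : ∀ i, xi i ∈ closure Ω)
    (lam : Fin k → ℝ) (hlam : ∀ i, 0 < lam i) (hsum : ∑ i, lam i = 1)
    (hxrep : x = ∑ i, lam i • xi i)
    (hwrep : wss x = ∑ i, lam i * w (xi i)) :
    ∀ i, xi i ∈ Ω := by
  intro i
  by_contra hi
  obtain ⟨y, R, hR, hball, hzy⟩ := hsphere (xi i) (hΩo.frontier_eq ▸ ⟨hxi i, hi⟩)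
  have hz0 : w (xi i) = 0 := by
    simp [hw, hu.2.1 (xi i) (hΩo.frontier_eq ▸ ⟨hxi i, hi⟩)]
  have hnorm : ‖xi i - y‖ = R := mem_sphere_iff_norm.1 hzy
  have hyΩ : y ∈ closure Ω := subset_closure (hball (mem_ball_self hR))
  obtain ⟨L, hL⟩ := hconv.exists_sub_mul_le
    (mem_of_superset (hΩo.mem_nhds hx) subset_closure) (y - xi i)
  set t : ℝ := R ^ 2 / (R ^ 2 + 4 * L ^ 2) with ht
  have hden : 0 < R ^ 2 + 4 * L ^ 2 := by positivity
  have ht0 : 0 < t := by positivity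
  have ht1 : t ≤ 1 := (div_le_one hden).2 (by nlinarith [sq_nonneg L])
  set p := xi i + t • (y - xi i) with hp
  have hpΩ : p ∈ closure Ω := hΩc.closure.add_smul_sub_mem (hxi i) hyΩ ⟨ht0.le, ht1⟩
  have hlower : R ^ 2 * t / 4 ≤ u p := by
    refine le_trans ?_ (hu.paraboloid_le hΩo hΩb hR.le hball hpΩ)
    have hpy : p - y = (1 - t) • (xi i - y) := by rw [hp]; module
    rw [hpy, norm_smul, hnorm, Real.norm_of_nonneg (by linarith)]
    nlinarith [mul_nonneg (sq_nonneg R) (mul_nonneg ht0.le (sub_nonneg.2 ht1))]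
  have hpts : ∀ j, Function.update xi i p j ∈ closure Ω := by
    intro j
    rcases eq_or_ne j i with rfl | hj
    · simpa using hpΩ
    · simpa [hj] using hxi j
  have hbary : ∑ j, lam j • Function.update xi i p j = x + (lam i * t) • (y - xi i) := by
    have hterm : ∀ j, lam j • Function.update xi i p j
        = lam j • xi j + if j = i then (lam i * t) • (y - xi i) else 0 := by
      intro j
      rcases eq_or_ne j i with rfl | hj
      · simp [hp, smul_smul]
      · simp [hj]
    simp [hterm, Finset.sum_add_distrib, ← hxrep]
  have hval : ∑ j, lam j * w (Function.update xi i p j) = wss x + lam i * w p := by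
    have hterm : ∀ j, lam j * w (Function.update xi i p j)
        = lam j * w (xi j) + if j = i then lam i * w p else 0 := by
      intro j
      rcases eq_or_ne j i with rfl | hj
      · simp [hz0]
      · simp [hj]
    simp [hterm, Finset.sum_add_distrib, ← hwrep]
  have hjensen : wss (x + (lam i * t) • (y - xi i)) ≤ wss x + lam i * w p := by
    rw [← hbary, ← hval]
    refine (hconv.map_sum_le (fun j _ => (hlam j).le) hsum fun j _ => hpts j).trans ?_
    exact Finset.sum_le_sum fun j _ => mul_le_mul_of_nonneg_left (hle _ (hpts j)) (hlam j).le
  have hmem : x + (lam i * t) • (y - xi i) ∈ closure Ω := by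
    rw [← hbary]
    exact hΩc.closure.sum_mem (fun j _ => (hlam j).le) hsum fun j _ => hpts j
  have hsqrt : Real.sqrt (u p) ≤ L * t := by
    have h := (hL _ (mul_pos (hlam i) ht0).le hmem).trans hjensen
    rw [hw] at h
    exact le_of_mul_le_mul_left (by linarith) (hlam i)
  have hupper : u p ≤ (L * t) ^ 2 := (Real.sqrt_le_left ((Real.sqrt_nonneg _).trans hsqrt)).1 hsqrt
  have hcancel : R ^ 2 ≤ 4 * L ^ 2 * t :=
    le_of_mul_le_mul_right (by nlinarith) ht0
  have hteq : t * (R ^ 2 + 4 * L ^ 2) = R ^ 2 := div_mul_cancel₀ _ hden.ne'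
  nlinarith [mul_pos ht0 (pow_pos hR 2)]
end

section
/- Let Ω ⊂ ℝ^n be an open bounded convex set satisfying an interior sphere condition (for every z ∈ ∂Ω there exists a ball B_R(y) ⊆ Ω with z ∈ ∂B_R(y)). Let w ∈ C(cl Ω), with w < 0 in Ω and w = 0 on ∂Ω, be a restricted viscosity supersolution in Ω of F(w,∇w,∇²w) = 0, where F(w,p,A) := −⟨Ap,p⟩ − (1/w)(|p|⁴ + (1/2)|p|²). Then the convex envelope w_** (the largest convex function on cl Ω below w) also vanishes on ∂Ω and is a restricted viscosity supersolution of the same equation in Ω. -/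
open Set Metric Filter
open scoped RealInnerProductSpace

open scoped Topology

/-- In finite dimension, the convex hull of a compact set is compact. -/
theorem IsCompact.convexHull_of_finiteDimensional {E : Type*} [NormedAddCommGroup E]
    [NormedSpace ℝ E] [FiniteDimensional ℝ E] {s : Set E} (hs : IsCompact s) :
    IsCompact (convexHull ℝ s) := by
  obtain rfl | ⟨a, ha⟩ := s.eq_empty_or_nonempty
  · simp
  set d := Module.finrank ℝ E + 1
  let f : (Fin d → ℝ) × (Fin d → E) → E := fun q => ∑ i, q.1 i • q.2 i
  have hf : Continuous f := by fun_prop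
  have hK : IsCompact (stdSimplex ℝ (Fin d) ×ˢ Set.pi univ fun _ : Fin d => s) :=
    (isCompact_stdSimplex ℝ (Fin d)).prod (isCompact_univ_pi fun _ => hs)
  convert hK.image hf using 1
  apply Subset.antisymm
  · intro x hx
    obtain ⟨ι, _, z, c, hz, hind, hc, hc1, hx⟩ := eq_pos_convex_span_of_mem_convexHull hx
    have hcard : Fintype.card ι ≤ Fintype.card (Fin d) := by
      rw [Fintype.card_fin]
      exact hind.card_le_finrank_succ.trans
        (Nat.succ_le_succ (Submodule.finrank_le _))
    obtain ⟨e⟩ := Function.Embedding.nonempty_of_card_le hcard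
    refine ⟨(Function.extend e c 0, Function.extend e z fun _ => a), ⟨⟨?_, ?_⟩, ?_⟩, ?_⟩
    · intro j
      by_cases hj : ∃ i, e i = j
      · obtain ⟨i, rfl⟩ := hj
        simpa [e.injective.extend_apply] using (hc i).le
      · simp [Function.extend_apply' _ _ _ hj]
    · rw [← hc1]
      refine (Fintype.sum_of_injective e e.injective _ _ (fun j hj => ?_) fun i => ?_).symm
      · simp [Function.extend_apply' _ _ _ hj]
      · simp [e.injective.extend_apply]
    · intro j _
      by_cases hj : ∃ i, e i = j
      · obtain ⟨i, rfl⟩ := hj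
        simpa [e.injective.extend_apply] using hz (mem_range_self i)
      · simpa [Function.extend_apply' _ _ _ hj] using ha
    · rw [← hx]
      refine (Fintype.sum_of_injective e e.injective _ _ (fun j hj => ?_) fun i => ?_).symm
      · simp [Function.extend_apply' _ _ _ hj]
      · simp [e.injective.extend_apply]
  · rintro _ ⟨⟨c, z⟩, ⟨⟨hc0, hc1⟩, hz⟩, rfl⟩
    exact mem_convexHull_of_exists_fintype c z hc0 hc1 (fun i => hz i (mem_univ i)) rfl

/-- A restricted supersolution may be tested by functions that are only locally `C²` and
only touch it locally, up to an additive constant. -/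
theorem IsRestrictedSupersol.Ffun_nonneg_of_isLocalMin {n : ℕ}
    {Ω : Set (EuclideanSpace ℝ (Fin n))} {w ψ : EuclideanSpace ℝ (Fin n) → ℝ}
    {x : EuclideanSpace ℝ (Fin n)} (hΩ : IsOpen Ω) (h : IsRestrictedSupersol Ω w)
    (hb : BddBelow (w '' Ω)) (hx : x ∈ Ω) (hψ : ContDiffAt ℝ 2 ψ x)
    (hmin : IsLocalMin (fun y => w y - ψ y) x) :
    0 ≤ Ffun (w x) (gradient ψ x) (hessianCLM ψ x) := by
  obtain ⟨B, hB⟩ := hb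
  have hev := (hψ.eventually (by simp)).and (hmin.and (hΩ.eventually_mem hx))
  obtain ⟨R, hR, hball⟩ := Metric.eventually_nhds_iff_ball.1 hev
  let χ : ContDiffBump x := ⟨R / 4, R / 2, by linarith, by linarith⟩
  have hχR : closedBall x χ.rOut ⊆ ball x R := closedBall_subset_ball (by change R / 2 < R; linarith)
  set c := w x - ψ x with hc
  let g : EuclideanSpace ℝ (Fin n) → ℝ := fun y => χ y * (ψ y + c - B)
  have hg : ContDiff ℝ 2 g := by
    rw [contDiff_iff_contDiffAt]
    intro y
    by_cases hy : y ∈ tsupport χ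
    · rw [χ.tsupport_eq] at hy
      exact χ.contDiffAt.mul ((((hball y (hχR hy)).1).add contDiffAt_const).sub contDiffAt_const)
    · have h0 : g =ᶠ[𝓝 y] fun _ => 0 := by
        filter_upwards [notMem_tsupport_iff_eventuallyEq.1 hy] with z hz
        simp [g, hz]
      exact contDiffAt_const.congr_of_eventuallyEq h0
  have hloc : (fun y => g y + B) =ᶠ[𝓝 x] fun y => ψ y + c := by
    filter_upwards [χ.eventuallyEq_one] with y hy
    simp [g, hy]
  have hgrad : gradient (fun y => g y + B) =ᶠ[𝓝 x] gradient ψ := by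
    refine hloc.gradient.trans (Eventually.of_forall fun y => ?_)
    simp [gradient]
  have key := (h.2 x hx (fun y => g y + B) (hg.add contDiff_const).contDiffOn
    (hloc.self_of_nhds.trans (add_sub_cancel _ _)) ?_).1
  · rw [hgrad.self_of_nhds] at key
    have : hessianCLM (fun y => g y + B) x = hessianCLM ψ x := hgrad.fderiv_eq
    rwa [this] at key
  · intro y hy
    have hBy : B ≤ w y := hB (mem_image_of_mem w hy)
    by_cases hyR : y ∈ ball x R
    · have h1 := (hball y hyR).2.1
      have h1' : ψ y + c ≤ w y := by linarith
      have h2 := χ.nonneg' y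
      have h3 : χ y ≤ 1 := χ.le_one
      change χ y * (ψ y + c - B) + B ≤ w y
      nlinarith
    · have : χ y = 0 := by
        apply χ.zero_of_le_dist
        have : R ≤ dist y x := by simpa using hyR
        exact le_trans (by change R / 2 ≤ R; linarith) this
      simpa [g, this] using hBy

/-- Second order Taylor expansion, as a lower bound. -/
theorem ContDiffAt.eventually_taylor_two_le {n : ℕ} {ψ : EuclideanSpace ℝ (Fin n) → ℝ}
    {x : EuclideanSpace ℝ (Fin n)} (hψ : ContDiffAt ℝ 2 ψ x) {ε : ℝ} (hε : 0 < ε) :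
    ∀ᶠ z in 𝓝 (0 : EuclideanSpace ℝ (Fin n)),
      ψ x + ⟪gradient ψ x, z⟫ + 1 / 2 * ⟪hessianCLM ψ x z, z⟫ - ε * ‖z‖ ^ 2 ≤ ψ (x + z) := by
  have hgd : DifferentiableAt ℝ (gradient ψ) x := by
    have h1 : DifferentiableAt ℝ (fderiv ℝ ψ) x :=
      (hψ.fderiv_right (m := 1) (by norm_num)).differentiableAt (by norm_num)
    exact (InnerProductSpace.toDual ℝ _).symm.toContinuousLinearEquiv.differentiableAt.comp x h1
  have hd := hgd.hasFDerivAt.isLittleO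
  have h1 : ∀ᶠ y in 𝓝 x, ‖gradient ψ y - gradient ψ x - hessianCLM ψ x (y - x)‖ ≤ ε * ‖y - x‖ :=
    hd.def hε
  have h2 : ∀ᶠ y in 𝓝 x, DifferentiableAt ℝ ψ y := by
    filter_upwards [hψ.eventually (by simp)] with y hy
    exact hy.differentiableAt (by norm_num)
  obtain ⟨R, hR, hball⟩ := Metric.eventually_nhds_iff_ball.1 (h1.and h2)
  filter_upwards [Metric.ball_mem_nhds (0 : EuclideanSpace ℝ (Fin n)) hR] with z hz
  have hz' : ‖z‖ < R := by simpa using hz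
  have hmem : ∀ t ∈ Icc (0 : ℝ) 1, x + t • z ∈ ball x R := by
    intro t ht
    rw [mem_ball_iff_norm]
    simp only [add_sub_cancel_left, norm_smul, Real.norm_eq_abs, abs_of_nonneg ht.1]
    nlinarith [norm_nonneg z, ht.1, ht.2]
  have hder : ∀ t ∈ Icc (0 : ℝ) 1,
      HasDerivAt (fun t : ℝ => ψ (x + t • z)) ⟪gradient ψ (x + t • z), z⟫ t := by
    intro t ht
    have hl : HasDerivAt (fun t : ℝ => x + t • z) z t := by
      simpa using ((hasDerivAt_id t).smul_const z).const_add x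
    have := (hball _ (hmem t ht)).2.hasFDerivAt.comp_hasDerivAt t hl
    rwa [← inner_gradient_left] at this
  have hB : ∀ t : ℝ, HasDerivAt (fun t : ℝ => ψ x + t * ⟪gradient ψ x, z⟫
      + t ^ 2 / 2 * ⟪hessianCLM ψ x z, z⟫ - t * (ε * ‖z‖ ^ 2))
      (⟪gradient ψ x, z⟫ + t * ⟪hessianCLM ψ x z, z⟫ - ε * ‖z‖ ^ 2) t := by
    intro t
    have e1 := (hasDerivAt_id t).mul_const ⟪gradient ψ x, z⟫
    have e2 := (((hasDerivAt_id t).pow 2).div_const 2).mul_const ⟪hessianCLM ψ x z, z⟫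
    have e3 := (hasDerivAt_id t).mul_const (ε * ‖z‖ ^ 2)
    convert! ((e1.const_add (ψ x)).add e2).sub e3 using 1
    simp
  have := image_le_of_deriv_right_le_deriv_boundary (a := 0) (b := 1)
    (f := fun t : ℝ => ψ x + t * ⟪gradient ψ x, z⟫
      + t ^ 2 / 2 * ⟪hessianCLM ψ x z, z⟫ - t * (ε * ‖z‖ ^ 2))
    (B := fun t : ℝ => ψ (x + t • z))
    (fun t _ => (hB t).continuousAt.continuousWithinAt)
    (fun t _ => (hB t).hasDerivWithinAt) (by simp)
    (fun t ht => (hder t ht).continuousAt.continuousWithinAt)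
    (fun t ht => (hder t (Ico_subset_Icc_self ht)).hasDerivWithinAt)
    (fun t ht => ?_) (right_mem_Icc.2 zero_le_one)
  · simp only [one_smul, one_mul, one_pow] at this
    linarith
  · have h3 := (hball _ (hmem t (Ico_subset_Icc_self ht))).1
    simp only [add_sub_cancel_left, map_smul] at h3
    rw [norm_smul, Real.norm_eq_abs, abs_of_nonneg ht.1] at h3
    have h4 := neg_le_of_abs_le ((abs_real_inner_le_norm
      (gradient ψ (x + t • z) - gradient ψ x - t • hessianCLM ψ x z) z))
    rw [inner_sub_left, inner_sub_left, real_inner_smul_left] at h4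
    have h5 : ‖gradient ψ (x + t • z) - gradient ψ x - t • hessianCLM ψ x z‖ * ‖z‖
        ≤ ε * ‖z‖ ^ 2 := by
      calc _ ≤ (ε * (t * ‖z‖)) * ‖z‖ := by gcongr
        _ = t * (ε * ‖z‖ ^ 2) := by ring
        _ ≤ 1 * (ε * ‖z‖ ^ 2) := by gcongr; exact ht.2.le
        _ = _ := one_mul _
    linarith

/-- The radial test function `k - a |y - c| + b/2 |y - c|²`. -/
noncomputable def radialParabola {n : ℕ} (c : EuclideanSpace ℝ (Fin n)) (k a b : ℝ) :
    EuclideanSpace ℝ (Fin n) → ℝ :=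
  fun y => k - a * ‖y - c‖ + b / 2 * ‖y - c‖ ^ 2

theorem continuous_radialParabola {n : ℕ} (c : EuclideanSpace ℝ (Fin n)) (k a b : ℝ) :
    Continuous (radialParabola c k a b) := by
  unfold radialParabola
  fun_prop

theorem contDiffAt_radialParabola {n : ℕ} {c y : EuclideanSpace ℝ (Fin n)} (hy : y ≠ c)
    (k a b : ℝ) : ContDiffAt ℝ 2 (radialParabola c k a b) y := by
  have h : ContDiffAt ℝ 2 (fun y => y - c) y := contDiffAt_id.sub contDiffAt_const
  exact (contDiffAt_const.sub (contDiffAt_const.mul (h.norm ℝ (sub_ne_zero.2 hy)))).add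
    (contDiffAt_const.mul (h.norm_sq ℝ))

theorem gradient_radialParabola {n : ℕ} {c y : EuclideanSpace ℝ (Fin n)} (hy : y ≠ c)
    (k a b : ℝ) :
    gradient (radialParabola c k a b) y = (b - a / ‖y - c‖) • (y - c) := by
  have h0 : ‖y - c‖ ≠ 0 := norm_ne_zero_iff.2 (sub_ne_zero.2 hy)
  have hsq := ((hasFDerivAt_id y).sub_const c).norm_sq
  have hn := hsq.sqrt (by simpa using h0)
  simp only [id, Real.sqrt_sq (norm_nonneg _)] at hn hsq
  refine HasGradientAt.gradient (hasGradientAt_iff_hasFDerivAt.2 ?_)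
  have := ((hn.const_mul a).const_sub k).add (hsq.const_mul (b / 2))
  refine this.congr_fderiv ?_
  ext v
  simp
  field_simp
  ring

theorem hessianCLM_radialParabola {n : ℕ} {c y : EuclideanSpace ℝ (Fin n)} (hy : y ≠ c)
    (k a b : ℝ) :
    hessianCLM (radialParabola c k a b) y (y - c) = b • (y - c) := by
  have h0 : 0 < ‖y - c‖ := norm_pos_iff.2 (sub_ne_zero.2 hy)
  have hgd : DifferentiableAt ℝ (gradient (radialParabola c k a b)) y := by
    have h1 : DifferentiableAt ℝ (fderiv ℝ (radialParabola c k a b)) y :=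
      ((contDiffAt_radialParabola hy k a b).fderiv_right (m := 1) (by norm_num)).differentiableAt
        (by norm_num)
    exact (InnerProductSpace.toDual ℝ _).symm.toContinuousLinearEquiv.differentiableAt.comp y h1
  have hl : HasDerivAt (fun t : ℝ => c + t • (y - c)) (y - c) 1 := by
    simpa using ((hasDerivAt_id (1 : ℝ)).smul_const (y - c)).const_add c
  have h1 : HasDerivAt (fun t : ℝ => gradient (radialParabola c k a b) (c + t • (y - c)))
      (hessianCLM (radialParabola c k a b) y (y - c)) 1 := by
    have hy' : c + (1 : ℝ) • (y - c) = y := by simp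
    have h2 := hgd.hasFDerivAt
    nth_rw 2 [← hy'] at h2
    exact h2.comp_hasDerivAt (1 : ℝ) hl
  have h2 : HasDerivAt (fun t : ℝ => (b * t - a / ‖y - c‖) • (y - c)) (b • (y - c)) 1 := by
    have : HasDerivAt (fun t : ℝ => b * t - a / ‖y - c‖) b 1 := by
      simpa using ((hasDerivAt_id (1 : ℝ)).const_mul b).sub_const (a / ‖y - c‖)
    exact this.smul_const _
  refine h1.unique (h2.congr_of_eventuallyEq ?_)
  filter_upwards [eventually_gt_nhds (zero_lt_one' ℝ)] with t ht
  have hne : c + t • (y - c) ≠ c := by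
    simpa [ht.ne'] using sub_ne_zero.2 hy
  rw [gradient_radialParabola hne, add_sub_cancel_left, norm_smul, Real.norm_eq_abs, abs_of_pos ht,
    smul_smul]
  congr 1
  field_simp

/-- The differential inequality that a radial test function with nonvanishing gradient satisfies. -/
theorem mul_neg_le_of_Ffun_radialParabola_nonneg {n : ℕ} {c y : EuclideanSpace ℝ (Fin n)}
    (hy : y ≠ c) {k a b m : ℝ} (hm : m < 0) (hab : b * ‖y - c‖ - a ≠ 0)
    (hF : 0 ≤ Ffun m (gradient (radialParabola c k a b) y)
      (hessianCLM (radialParabola c k a b) y)) :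
    b * -m ≤ (b * ‖y - c‖ - a) ^ 2 + 1 / 2 := by
  have h0 : 0 < ‖y - c‖ := norm_pos_iff.2 (sub_ne_zero.2 hy)
  rw [Ffun, gradient_radialParabola hy, map_smul, hessianCLM_radialParabola hy] at hF
  simp only [real_inner_smul_left, real_inner_smul_right, real_inner_self_eq_norm_sq,
    norm_smul, Real.norm_eq_abs, mul_pow] at hF
  have h4 : |b - a / ‖y - c‖| ^ 4 * ‖y - c‖ ^ 4 = (b * ‖y - c‖ - a) ^ 4 := by
    rw [Even.pow_abs (by decide), ← mul_pow]
    congr 1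
    field_simp
  have h2 : |b - a / ‖y - c‖| ^ 2 * ‖y - c‖ ^ 2 = (b * ‖y - c‖ - a) ^ 2 := by
    rw [sq_abs, ← mul_pow]
    congr 1
    field_simp
  rw [h4, h2] at hF
  have h3 : (b - a / ‖y - c‖) * ((b - a / ‖y - c‖) * (b * ‖y - c‖ ^ 2))
      = b * (b * ‖y - c‖ - a) ^ 2 := by
    field_simp
  rw [h3] at hF
  have hq : 0 < (b * ‖y - c‖ - a) ^ 2 := by positivity
  set q := b * ‖y - c‖ - a
  have h5 : q ^ 2 * (b * -m) ≤ q ^ 2 * (q ^ 2 + 1 / 2) := by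
    have h6 : 0 ≤ -m * (-(b * q ^ 2) - 1 / m * (q ^ 4 + 1 / 2 * q ^ 2)) :=
      mul_nonneg (by linarith) hF
    have h7 : -m * (-(b * q ^ 2) - 1 / m * (q ^ 4 + 1 / 2 * q ^ 2))
        = m * (b * q ^ 2) + (q ^ 4 + 1 / 2 * q ^ 2) := by
      field_simp [hm.ne]
      ring
    nlinarith
  exact le_of_mul_le_mul_left h5 hq

/-- At a point where a supersolution is supported by an affine function with slope `p ≠ 0`, it
descends at least at the rate of a parabola whose opening is prescribed by the equation. -/
theorem IsRestrictedSupersol.eventually_exists_le_parabola {n : ℕ}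
    {Ω : Set (EuclideanSpace ℝ (Fin n))} {w : EuclideanSpace ℝ (Fin n) → ℝ}
    {x p : EuclideanSpace ℝ (Fin n)} (hΩ : IsOpen Ω) (h : IsRestrictedSupersol Ω w)
    (hb : BddBelow (w '' Ω)) (hwc : ContinuousOn w Ω) (hneg : ∀ y ∈ Ω, w y < 0) (hx : x ∈ Ω)
    (hp : p ≠ 0) (hsupp : ∀ y ∈ Ω, w x + ⟪p, y - x⟫ ≤ w y) {b : ℝ}
    (hbw : ‖p‖ ^ 2 + 1 / 2 < b * -w x) :
    ∀ᶠ r in 𝓝[>] (0 : ℝ), ∃ y ∈ Ω, ‖y - x‖ ≤ r ∧ w y ≤ w x - ‖p‖ * r + b / 2 * r ^ 2 := by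
  have hp0 : 0 < ‖p‖ := norm_pos_iff.2 hp
  have hwx := hneg x hx
  have hb0 : 0 < b := by
    by_contra! hb'
    nlinarith [sq_nonneg ‖p‖]
  have hwcx : ContinuousAt w x := hwc.continuousAt (hΩ.mem_nhds hx)
  have hev : ∀ᶠ y in 𝓝 x, y ∈ Ω ∧ ‖p‖ ^ 2 + 1 / 2 < b * -w y :=
    (hΩ.eventually_mem hx).and ((hwcx.neg.const_mul b).eventually (lt_mem_nhds hbw))
  obtain ⟨R, hR, hball⟩ := Metric.eventually_nhds_iff_ball.1 hev
  have hr1 : ∀ᶠ r in 𝓝[>] (0 : ℝ), r < R ∧ r < ‖p‖ / (2 * b) :=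
    (eventually_nhdsWithin_of_eventually_nhds (eventually_lt_nhds hR)).and
      (eventually_nhdsWithin_of_eventually_nhds (eventually_lt_nhds (by positivity)))
  filter_upwards [hr1, self_mem_nhdsWithin] with r hr hr0
  have hr0 : 0 < r := hr0
  obtain ⟨hrR, hrp⟩ := hr
  rw [lt_div_iff₀ (by positivity)] at hrp
  have hcb : closedBall x r ⊆ ball x R := closedBall_subset_ball hrR
  have hcΩ : closedBall x r ⊆ Ω := fun y hy => (hball y (hcb hy)).1
  by_contra! hcon
  obtain ⟨y₀, hy₀, hy₀min⟩ := (isCompact_closedBall x r).exists_isMinOn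
    (nonempty_closedBall.2 hr0.le) (hwc.mono hcΩ)
  have hη := hcon y₀ (hcΩ hy₀) (mem_closedBall_iff_norm.1 hy₀)
  have hlim : Tendsto (fun s : ℝ => w x + s * ‖p‖ - ‖p‖ * (r - s) + b / 2 * (r + s) ^ 2)
      (𝓝[>] 0) (𝓝 (w x - ‖p‖ * r + b / 2 * r ^ 2)) := by
    refine tendsto_nhdsWithin_of_tendsto_nhds ?_
    have : Continuous fun s : ℝ => w x + s * ‖p‖ - ‖p‖ * (r - s) + b / 2 * (r + s) ^ 2 := by
      fun_prop
    simpa using this.tendsto 0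
  obtain ⟨s, ⟨hs, hsr⟩, hs0⟩ := ((hlim.eventually (gt_mem_nhds hη)).and
    (eventually_nhdsWithin_of_eventually_nhds (eventually_lt_nhds hr0)) |>.and
    self_mem_nhdsWithin).exists
  have hs0 : 0 < s := hs0
  set c := x + (s / ‖p‖) • p with hc
  have hxc : ‖x - c‖ = s := by
    rw [hc, sub_add_cancel_left, norm_neg, norm_smul, Real.norm_eq_abs, abs_of_pos (by positivity)]
    field_simp
  have hcx : ‖c - x‖ = s := by rw [norm_sub_rev, hxc]
  set ψ := radialParabola c (w x + s * ‖p‖) ‖p‖ b with hψ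
  obtain ⟨y, hy, hymin⟩ := (isCompact_closedBall x r).exists_isMinOn
    (nonempty_closedBall.2 hr0.le)
    ((hwc.mono hcΩ).sub (continuous_radialParabola c (w x + s * ‖p‖) ‖p‖ b).continuousOn)
  have hyx : w y - ψ y < 0 := by
    have h1 : w y - ψ y ≤ w x - ψ x := hymin (mem_closedBall_self hr0.le)
    have h2 : ψ x = w x + s * ‖p‖ - ‖p‖ * s + b / 2 * s ^ 2 := by
      simp only [hψ, radialParabola, hxc]
    have h3 : 0 < b / 2 * s ^ 2 := by positivity
    linarith
  have hyr := mem_closedBall_iff_norm.1 hy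
  have hyc : y ≠ c := by
    rintro rfl
    have h1 := hsupp c (hcΩ hy)
    have h2 : ⟪p, c - x⟫ = s * ‖p‖ := by
      rw [hc, add_sub_cancel_left, real_inner_smul_right, real_inner_self_eq_norm_sq]
      field_simp
    have h3 : ψ c = w x + s * ‖p‖ := by simp [hψ, radialParabola]
    linarith
  have hyr' : ‖y - x‖ < r := by
    refine lt_of_le_of_ne hyr fun heq => ?_
    have h1 : w y₀ ≤ w y := hy₀min hy
    have h2 : ‖y - c‖ ≤ r + s := by
      have := norm_sub_le_norm_sub_add_norm_sub y x c
      linarith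
    have h3 : r - s ≤ ‖y - c‖ := by
      have := norm_sub_le_norm_sub_add_norm_sub y c x
      linarith
    have h4 : ψ y ≤ w x + s * ‖p‖ - ‖p‖ * (r - s) + b / 2 * (r + s) ^ 2 := by
      simp only [hψ, radialParabola]
      gcongr
    linarith
  have hyb : y ∈ ball x r := mem_ball_iff_norm.2 hyr'
  have hloc : IsLocalMin (fun y => w y - ψ y) y :=
    hymin.isLocalMin (mem_of_superset (isOpen_ball.mem_nhds hyb) ball_subset_closedBall)
  have hρ : ‖y - c‖ < 2 * r := by
    have := norm_sub_le_norm_sub_add_norm_sub y x c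
    linarith
  have hbρ : b * ‖y - c‖ < ‖p‖ := by nlinarith
  have key := mul_neg_le_of_Ffun_radialParabola_nonneg hyc (hneg y (hcΩ hy)) (by linarith)
    (h.Ffun_nonneg_of_isLocalMin hΩ hb (hcΩ hy)
      (contDiffAt_radialParabola hyc (w x + s * ‖p‖) ‖p‖ b) hloc)
  have := (hball y (hcb hy)).2
  have : 0 ≤ b * ‖y - c‖ := by positivity
  nlinarith

theorem convexOn_clm_add_const {E : Type*} [NormedAddCommGroup E] [NormedSpace ℝ E] {s : Set E}
    (hs : Convex ℝ s) (f : StrongDual ℝ E) (k : ℝ) : ConvexOn ℝ s fun y => f y + k :=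
  (f.toLinearMap.convexOn hs).add_const k

/-- The gradient of a function touching a convex function from below is a subgradient. -/
theorem ConvexOn.add_inner_gradient_le_of_isLocalMin {E : Type*} [NormedAddCommGroup E]
    [InnerProductSpace ℝ E] [CompleteSpace E] {s : Set E} {g ψ : E → ℝ} {x y : E}
    (hg : ConvexOn ℝ s g) (hx : x ∈ s) (hψ : DifferentiableAt ℝ ψ x)
    (hmin : IsLocalMin (fun y => g y - ψ y) x) (hy : y ∈ s) :
    g x + ⟪gradient ψ x, y - x⟫ ≤ g y := by
  have hl : HasDerivAt (fun t : ℝ => x + t • (y - x)) (y - x) 0 := by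
    simpa using ((hasDerivAt_id (0 : ℝ)).smul_const (y - x)).const_add x
  have hx0 : x + (0 : ℝ) • (y - x) = x := by simp
  have hd : HasDerivAt (fun t : ℝ => ψ (x + t • (y - x))) ⟪gradient ψ x, y - x⟫ 0 := by
    have h2 := hψ.hasFDerivAt
    nth_rw 2 [← hx0] at h2
    rw [inner_gradient_left]
    exact h2.comp_hasDerivAt (0 : ℝ) hl
  have hc : Tendsto (fun t : ℝ => x + t • (y - x)) (𝓝 0) (𝓝 x) := by
    simpa using hl.continuousAt.tendsto
  suffices ⟪gradient ψ x, y - x⟫ ≤ g y - g x by linarith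
  refine le_of_tendsto hd.tendsto_slope_zero_right ?_
  filter_upwards [eventually_nhdsWithin_of_eventually_nhds (hc.eventually hmin),
    eventually_nhdsWithin_of_eventually_nhds (eventually_lt_nhds (zero_lt_one' ℝ)),
    self_mem_nhdsWithin] with t ht ht1 ht0
  have ht0 : 0 < t := ht0
  simp only [zero_add, hx0, smul_eq_mul]
  rw [inv_mul_le_iff₀ ht0]
  have h1 := hg.2 hx hy (sub_nonneg.2 ht1.le) ht0.le (sub_add_cancel 1 t)
  have h2 : (1 - t) • x + t • y = x + t • (y - x) := by module
  rw [h2, smul_eq_mul, smul_eq_mul] at h1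
  linarith

/-- A point lies in the convex hull of the set where a function touches a supporting affine
function of its convex envelope at that point. -/
theorem mem_convexHull_contact_of_convexEnvelope {E : Type*} [NormedAddCommGroup E]
    [InnerProductSpace ℝ E] [FiniteDimensional ℝ E] {s : Set E} {w wss : E → ℝ} {x p : E}
    (hs : IsCompact s) (hsc : Convex ℝ s) (hwc : ContinuousOn w s)
    (hle : ∀ y ∈ s, wss y ≤ w y)
    (hmax : ∀ g : E → ℝ, ConvexOn ℝ s g → (∀ y ∈ s, g y ≤ w y) → ∀ y ∈ s, g y ≤ wss y)
    (hx : x ∈ s) (hsupp : ∀ y ∈ s, wss x + ⟪p, y - x⟫ ≤ wss y) :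
    x ∈ convexHull ℝ {y | y ∈ s ∧ w y = wss x + ⟪p, y - x⟫} := by
  set l : E → ℝ := fun y => wss x + ⟪p, y - x⟫ with hl
  have hlc : Continuous l := by fun_prop
  have hwl : ContinuousOn (fun y => w y - l y) s := hwc.sub hlc.continuousOn
  have hKeq : {y | y ∈ s ∧ w y = l y} = s ∩ (fun y => w y - l y) ⁻¹' {0} := by
    ext y
    simp [sub_eq_zero]
  have hK : IsCompact {y | y ∈ s ∧ w y = l y} := by
    rw [hKeq]
    exact hs.of_isClosed_subset (hwl.preimage_isClosed_of_isClosed hs.isClosed isClosed_singleton)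
      inter_subset_left
  by_contra hcon
  obtain ⟨f, u, hfu, hux⟩ := geometric_hahn_banach_closed_point (convex_convexHull ℝ _)
    hK.convexHull_of_finiteDimensional.isClosed hcon
  have hT : IsCompact (s ∩ {y | u ≤ f y}) :=
    hs.inter_right (isClosed_le continuous_const f.continuous)
  have hTne : (s ∩ {y | u ≤ f y}).Nonempty := ⟨x, hx, hux.le⟩
  obtain ⟨y₁, hy₁, hmin⟩ := hT.exists_isMinOn hTne (hwl.mono inter_subset_left)
  obtain ⟨y₂, hy₂, hmx⟩ := hT.exists_isMaxOn hTne f.continuous.continuousOn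
  set η := w y₁ - l y₁ with hη
  have hlw : ∀ y ∈ s, l y ≤ w y := fun y hy => (hsupp y hy).trans (hle y hy)
  have hη0 : 0 < η := by
    refine lt_of_le_of_ne (sub_nonneg.2 (hlw y₁ hy₁.1)) fun h0 => ?_
    have hm : y₁ ∈ {y | y ∈ s ∧ w y = l y} := ⟨hy₁.1, sub_eq_zero.1 h0.symm⟩
    exact absurd (hfu y₁ (subset_convexHull ℝ _ hm)) (not_lt.2 hy₁.2)
  have hC : 0 < f y₂ - u := by
    have : f x ≤ f y₂ := hmx ⟨hx, hux.le⟩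
    linarith
  set ε := η / (f y₂ - u) with hε
  have hε0 : 0 < ε := div_pos hη0 hC
  have hεη : ε * (f y₂ - u) = η := by rw [hε]; field_simp
  have hgeq : (fun y => (innerSL ℝ p + ε • f) y + (wss x - ⟪p, x⟫ - ε * u))
      = fun y => l y + ε * (f y - u) := by
    funext y
    simp [hl, inner_sub_right]
    ring
  have hg : ConvexOn ℝ s fun y => l y + ε * (f y - u) :=
    hgeq ▸ convexOn_clm_add_const hsc (innerSL ℝ p + ε • f) (wss x - ⟪p, x⟫ - ε * u)
  have := hmax _ hg (fun y hy => ?_) x hx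
  · simp only [hl, sub_self, inner_zero_right, add_zero] at this
    nlinarith [mul_pos hε0 (sub_pos.2 hux)]
  · by_cases hy' : u ≤ f y
    · have h1 : η ≤ w y - l y := hmin ⟨hy, hy'⟩
      have h2 : f y ≤ f y₂ := hmx ⟨hy, hy'⟩
      have h3 : ε * (f y - u) ≤ ε * (f y₂ - u) := by gcongr
      linarith
    · have h1 : ε * (f y - u) ≤ 0 := mul_nonpos_of_nonneg_of_nonpos hε0.le (by linarith)
      linarith [hlw y hy]

/-- On a bounded convex open set, the convex envelope of a function that vanishes on the boundary
vanishes on the boundary. -/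
theorem convexEnvelope_eq_zero_on_frontier {E : Type*} [NormedAddCommGroup E]
    [NormedSpace ℝ E] {Ω : Set E} {w wss : E → ℝ}
    (hΩo : IsOpen Ω) (hcpt : IsCompact (closure Ω)) (hΩc : Convex ℝ Ω)
    (hwc : ContinuousOn w (closure Ω)) (hw0 : ∀ x ∈ frontier Ω, w x = 0)
    (hle : ∀ y ∈ closure Ω, wss y ≤ w y)
    (hmax : ∀ g : E → ℝ, ConvexOn ℝ (closure Ω) g → (∀ y ∈ closure Ω, g y ≤ w y) →
      ∀ y ∈ closure Ω, g y ≤ wss y) {z : E} (hz : z ∈ frontier Ω) : wss z = 0 := by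
  have hzc : z ∈ closure Ω := frontier_subset_closure hz
  refine le_antisymm ((hle z hzc).trans_eq (hw0 z hz)) ?_
  have hzΩ : z ∉ Ω := by
    rw [hΩo.frontier_eq] at hz
    exact hz.2
  obtain ⟨f, hf⟩ := geometric_hahn_banach_open_point hΩc hΩo hzΩ
  have hfle : ∀ y ∈ closure Ω, f y ≤ f z := fun y hy =>
    le_on_closure (fun y hy => (hf y hy).le) f.continuous.continuousOn continuousOn_const hy
  refine le_of_forall_pos_le_add fun ε hε => ?_
  have hT : IsCompact (closure Ω ∩ w ⁻¹' Iic (-ε)) :=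
    hcpt.of_isClosed_subset (hwc.preimage_isClosed_of_isClosed isClosed_closure isClosed_Iic)
      inter_subset_left
  obtain ⟨K, hK0, hK⟩ : ∃ K : ℝ, 0 ≤ K ∧
      ∀ y ∈ closure Ω ∩ w ⁻¹' Iic (-ε), -ε + K * (f y - f z) ≤ w y := by
    obtain hTe | hTne := (closure Ω ∩ w ⁻¹' Iic (-ε)).eq_empty_or_nonempty
    · exact ⟨0, le_rfl, by simp [hTe]⟩
    obtain ⟨y₁, hy₁, hmin⟩ := hT.exists_isMinOn hTne (hwc.mono inter_subset_left)
    obtain ⟨y₂, hy₂, hmx⟩ := hT.exists_isMaxOn hTne f.continuous.continuousOn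
    have hy₂Ω : y₂ ∈ Ω := by
      by_contra hn
      have h1 := hw0 y₂ (by rw [hΩo.frontier_eq]; exact ⟨hy₂.1, hn⟩)
      have h2 : w y₂ ≤ -ε := hy₂.2
      linarith
    have hδ : 0 < f z - f y₂ := sub_pos.2 (hf y₂ hy₂Ω)
    have hw₁ : w y₁ ≤ -ε := hy₁.2
    have hK0 : 0 ≤ (-w y₁) / (f z - f y₂) := div_nonneg (by linarith) hδ.le
    refine ⟨(-w y₁) / (f z - f y₂), hK0, fun y hy => ?_⟩
    have h1 : w y₁ ≤ w y := hmin hy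
    have h2 : f y ≤ f y₂ := hmx hy
    have h3 : (-w y₁) / (f z - f y₂) * (f z - f y₂) = -w y₁ := by field_simp
    nlinarith
  have hgeq : (fun y => (K • f) y + (-ε - K * f z)) = fun y => -ε + K * (f y - f z) := by
    funext y
    simp
    ring
  have hg : ConvexOn ℝ (closure Ω) fun y => -ε + K * (f y - f z) :=
    hgeq ▸ convexOn_clm_add_const hΩc.closure (K • f) (-ε - K * f z)
  have := hmax _ hg (fun y hy => ?_) z hzc
  · simp only [sub_self, mul_zero, add_zero] at this
    linarith
  · by_cases hy' : w y ≤ -ε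
    · exact hK y ⟨hy, hy'⟩
    · have := mul_nonpos_of_nonneg_of_nonpos hK0 (sub_nonpos.2 (hfle y hy))
      linarith

/-- The descent property of a supersolution is inherited by its convex envelope. -/
theorem eventually_exists_convexEnvelope_le_parabola {n : ℕ}
    {Ω : Set (EuclideanSpace ℝ (Fin n))} {w wss : EuclideanSpace ℝ (Fin n) → ℝ}
    {x p : EuclideanSpace ℝ (Fin n)} (hΩo : IsOpen Ω) (hcpt : IsCompact (closure Ω))
    (hwc : ContinuousOn w (closure Ω)) (hneg : ∀ y ∈ Ω, w y < 0) (hw0 : ∀ y ∈ frontier Ω, w y = 0)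
    (hres : IsRestrictedSupersol Ω w) (hconv : ConvexOn ℝ (closure Ω) wss)
    (hle : ∀ y ∈ closure Ω, wss y ≤ w y)
    (hmax : ∀ g : EuclideanSpace ℝ (Fin n) → ℝ, ConvexOn ℝ (closure Ω) g →
      (∀ y ∈ closure Ω, g y ≤ w y) → ∀ y ∈ closure Ω, g y ≤ wss y)
    (hx : x ∈ Ω) (hp : p ≠ 0) (hsupp : ∀ y ∈ closure Ω, wss x + ⟪p, y - x⟫ ≤ wss y)
    {ε : ℝ} (hε : 0 < ε) :
    ∀ᶠ t in 𝓝[>] (0 : ℝ), ∃ y ∈ closure Ω, ‖y - x‖ ≤ t * -wss x ∧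
      wss y ≤ wss x - ‖p‖ * (t * -wss x)
        + t ^ 2 / 2 * ((‖p‖ ^ 2 + 1 / 2) * -wss x + ε) := by
  have hwb : BddBelow (w '' Ω) :=
    (hcpt.image_of_continuousOn hwc).bddBelow.mono (image_mono subset_closure)
  obtain ⟨ι, _, c, z, hc0, hc1, hz, hzx⟩ := mem_convexHull_iff_exists_fintype.1
    (mem_convexHull_contact_of_convexEnvelope hcpt hconv.1 hwc hle hmax (subset_closure hx) hsupp)
  have hpt : ∀ i, ∀ᶠ t in 𝓝[>] (0 : ℝ), ∃ y ∈ closure Ω, ‖y - z i‖ ≤ t * -w (z i) ∧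
      w y ≤ w (z i) - ‖p‖ * (t * -w (z i))
        + t ^ 2 / 2 * ((‖p‖ ^ 2 + 1 / 2) * -w (z i) + ε) := by
    intro i
    obtain ⟨hzi, hwzi⟩ := hz i
    by_cases hziΩ : z i ∈ Ω
    · have hm : 0 < -w (z i) := neg_pos.2 (hneg _ hziΩ)
      set m := -w (z i) with hmdef
      have hb : ‖p‖ ^ 2 + 1 / 2 < ((‖p‖ ^ 2 + 1 / 2) * m + ε) / m ^ 2 * m := by
        have : ((‖p‖ ^ 2 + 1 / 2) * m + ε) / m ^ 2 * m = ‖p‖ ^ 2 + 1 / 2 + ε / m := by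
          field_simp
        rw [this]
        have : 0 < ε / m := by positivity
        linarith
      have hev := hres.eventually_exists_le_parabola hΩo hwb (hwc.mono subset_closure) hneg hziΩ hp
        (fun y hy => ?_) hb
      · have htm : Tendsto (fun t : ℝ => t * m) (𝓝[>] 0) (𝓝[>] 0) := by
          refine tendsto_nhdsWithin_iff.2 ⟨tendsto_nhdsWithin_of_tendsto_nhds ?_, ?_⟩
          · have : Continuous fun t : ℝ => t * m := by fun_prop
            simpa using this.tendsto 0
          · filter_upwards [self_mem_nhdsWithin] with t ht
            exact mul_pos ht hm
        filter_upwards [htm.eventually hev] with t ht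
        obtain ⟨y, hy, hy1, hy2⟩ := ht
        refine ⟨y, subset_closure hy, hy1, hy2.trans_eq ?_⟩
        field_simp
      · have h1 := (hsupp y (subset_closure hy)).trans (hle y (subset_closure hy))
        rw [hwzi]
        have h2 : ⟪p, y - x⟫ = ⟪p, z i - x⟫ + ⟪p, y - z i⟫ := by
          rw [← inner_add_right]
          congr 1
          abel
        linarith
    · have h0 : w (z i) = 0 := hw0 _ (by rw [hΩo.frontier_eq]; exact ⟨hzi, hziΩ⟩)
      refine Eventually.of_forall fun t => ⟨z i, hzi, by simp [h0], ?_⟩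
      simp only [h0, neg_zero, mul_zero, sub_zero, zero_add]
      positivity
  have hM : ∑ i, c i * w (z i) = wss x := by
    have h1 : ∑ i, c i * ⟪p, z i - x⟫ = 0 := by
      have : ∑ i, c i • (z i - x) = 0 := by
        simp_rw [smul_sub]
        rw [Finset.sum_sub_distrib, hzx, ← Finset.sum_smul, hc1, one_smul, sub_self]
      simp_rw [← real_inner_smul_right]
      rw [← inner_sum, this, inner_zero_right]
    calc ∑ i, c i * w (z i) = ∑ i, (c i * wss x + c i * ⟪p, z i - x⟫) := by
          refine Finset.sum_congr rfl fun i _ => ?_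
          rw [(hz i).2]
          ring
      _ = wss x := by rw [Finset.sum_add_distrib, h1, ← Finset.sum_mul, hc1]; ring
  filter_upwards [eventually_all.2 hpt] with t ht
  choose y hy hy1 hy2 using ht
  refine ⟨∑ i, c i • y i, hconv.1.sum_mem (fun i _ => hc0 i) hc1 fun i _ => hy i, ?_, ?_⟩
  · calc ‖∑ i, c i • y i - x‖ = ‖∑ i, c i • (y i - z i)‖ := by
          simp_rw [smul_sub]
          rw [Finset.sum_sub_distrib, hzx]
      _ ≤ ∑ i, c i * (t * -w (z i)) := by
          refine norm_sum_le_of_le _ fun i _ => ?_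
          rw [norm_smul, Real.norm_eq_abs, abs_of_nonneg (hc0 i)]
          exact mul_le_mul_of_nonneg_left (hy1 i) (hc0 i)
      _ = t * -wss x := by
          rw [← hM, ← Finset.sum_neg_distrib, Finset.mul_sum]
          exact Finset.sum_congr rfl fun i _ => by ring
  · calc wss (∑ i, c i • y i) ≤ ∑ i, c i • wss (y i) :=
          hconv.map_sum_le (fun i _ => hc0 i) hc1 fun i _ => hy i
      _ ≤ ∑ i, c i * (w (z i) - ‖p‖ * (t * -w (z i))
            + t ^ 2 / 2 * ((‖p‖ ^ 2 + 1 / 2) * -w (z i) + ε)) :=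
          Finset.sum_le_sum fun i _ =>
            mul_le_mul_of_nonneg_left ((hle _ (hy i)).trans (hy2 i)) (hc0 i)
      _ = ∑ i, ((1 + ‖p‖ * t - t ^ 2 / 2 * (‖p‖ ^ 2 + 1 / 2)) * (c i * w (z i))
            + t ^ 2 / 2 * ε * c i) :=
          Finset.sum_congr rfl fun i _ => by ring
      _ = _ := by
          rw [Finset.sum_add_distrib, ← Finset.mul_sum, ← Finset.mul_sum, hM, hc1]
          ring

/-- Passing to the limit in vectors of norm at most `M` that nearly minimize `⟪p, ·⟫`. -/
theorem sq_mul_inner_le_of_forall_exists_approx {E : Type*} [NormedAddCommGroup E]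
    [InnerProductSpace ℝ E] {A : E →L[ℝ] E} {p : E} {M κ : ℝ} (hp : p ≠ 0) (hM : 0 ≤ M)
    (h : ∀ ε > 0, ∃ z, ‖z‖ ≤ M ∧ ⟪p, z⟫ ≤ -(‖p‖ * M) + ε ∧ ⟪A z, z⟫ ≤ κ + ε) :
    M ^ 2 * ⟪A p, p⟫ ≤ κ * ‖p‖ ^ 2 := by
  have hp0 : 0 < ‖p‖ := norm_pos_iff.2 hp
  choose z hz1 hz2 hz3 using fun k : ℕ => h (1 / ((k : ℝ) + 1)) (by positivity)
  have hlim := tendsto_one_div_add_atTop_nhds_zero_nat (𝕜 := ℝ)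
  set q : E := -(M / ‖p‖) • p with hq
  have hqn : ∀ k, ‖z k - q‖ ^ 2 ≤ 2 * M / ‖p‖ * (1 / ((k : ℝ) + 1)) := by
    intro k
    have h1 : ‖z k - q‖ ^ 2 = ‖z k‖ ^ 2 + 2 * (M / ‖p‖) * ⟪p, z k⟫ + M ^ 2 := by
      rw [norm_sub_sq_real, hq, real_inner_smul_right, norm_smul, norm_neg, Real.norm_eq_abs,
        abs_of_nonneg (by positivity), real_inner_comm]
      field_simp
      ring
    have h2 : ‖z k‖ ^ 2 ≤ M ^ 2 := by gcongr; exact hz1 k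
    have h3 : 2 * (M / ‖p‖) * ⟪p, z k⟫
        ≤ 2 * (M / ‖p‖) * (-(‖p‖ * M) + 1 / ((k : ℝ) + 1)) := by
      gcongr
      exact hz2 k
    have h4 : 2 * (M / ‖p‖) * (-(‖p‖ * M) + 1 / ((k : ℝ) + 1))
        = -(2 * M ^ 2) + 2 * M / ‖p‖ * (1 / ((k : ℝ) + 1)) := by
      field_simp
    linarith
  have hsq : Tendsto (fun k => ‖z k - q‖ ^ 2) atTop (𝓝 0) :=
    squeeze_zero (fun k => by positivity) hqn (by simpa using hlim.const_mul (2 * M / ‖p‖))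
  have hzq : Tendsto z atTop (𝓝 q) := by
    rw [tendsto_iff_norm_sub_tendsto_zero]
    simpa using hsq.sqrt
  have hA : Continuous fun z : E => ⟪A z, z⟫ := by fun_prop
  have hle : ⟪A q, q⟫ ≤ κ + 0 :=
    le_of_tendsto_of_tendsto' ((hA.tendsto q).comp hzq) (hlim.const_add κ) hz3
  have hqq : ⟪A q, q⟫ = (M / ‖p‖) ^ 2 * ⟪A p, p⟫ := by
    rw [hq, map_smul, real_inner_smul_left, real_inner_smul_right]
    ring
  rw [hqq, div_pow, add_zero, div_mul_eq_mul_div, div_le_iff₀ (by positivity)] at hle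
  exact hle

/-- A function with the descent property at `x` satisfies the differential inequality there. -/
theorem Ffun_nonneg_of_descent {n : ℕ} {s : Set (EuclideanSpace ℝ (Fin n))}
    {g ψ : EuclideanSpace ℝ (Fin n) → ℝ} {x : EuclideanSpace ℝ (Fin n)} (hgx : g x < 0)
    (hψ : ContDiffAt ℝ 2 ψ x) (hmin : IsLocalMin (fun y => g y - ψ y) x)
    (hp : gradient ψ x ≠ 0) (hsupp : ∀ y ∈ s, g x + ⟪gradient ψ x, y - x⟫ ≤ g y)
    (hdesc : ∀ ε > 0, ∀ᶠ t in 𝓝[>] (0 : ℝ), ∃ y ∈ s, ‖y - x‖ ≤ t * -g x ∧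
      g y ≤ g x - ‖gradient ψ x‖ * (t * -g x)
        + t ^ 2 / 2 * ((‖gradient ψ x‖ ^ 2 + 1 / 2) * -g x + ε)) :
    0 ≤ Ffun (g x) (gradient ψ x) (hessianCLM ψ x) := by
  set p := gradient ψ x with hpdef
  set A := hessianCLM ψ x with hA
  have hp0 : 0 < ‖p‖ := norm_pos_iff.2 hp
  obtain ⟨M, hM⟩ : ∃ M, M = -g x := ⟨_, rfl⟩
  have hM0 : 0 < M := by linarith
  rw [← hM] at hdesc
  have key : M ^ 2 * ⟪A p, p⟫ ≤ (‖p‖ ^ 2 + 1 / 2) * M * ‖p‖ ^ 2 := by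
    refine sq_mul_inner_le_of_forall_exists_approx hp hM0.le fun ε hε => ?_
    have hmin' : ∀ᶠ z in 𝓝 (0 : EuclideanSpace ℝ (Fin n)),
        g x - ψ x ≤ g (x + z) - ψ (x + z) := by
      have : Tendsto (fun z => x + z) (𝓝 0) (𝓝 x) := by
        simpa using (continuous_const_add x).tendsto 0
      exact this.eventually hmin
    obtain ⟨r, hr, hball⟩ := Metric.eventually_nhds_iff_ball.1
      ((hψ.eventually_taylor_two_le (ε := ε / (4 * M ^ 2)) (by positivity)).and hmin')
    set K := (‖p‖ ^ 2 + 1 / 2) * M + ε / 2 with hK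
    have hK0 : 0 < K := by positivity
    have hsm : ∀ ρ : ℝ, 0 < ρ → ∀ᶠ t in 𝓝[>] (0 : ℝ), t < ρ := fun ρ hρ =>
      eventually_nhdsWithin_of_eventually_nhds (eventually_lt_nhds hρ)
    obtain ⟨t, ⟨⟨⟨y, hys, hy1, hy2⟩, htr⟩, htK⟩, ht0⟩ :=
      ((((hdesc (ε / 2) (by positivity)).and (hsm (r / M) (by positivity))).and
        (hsm (ε / K) (by positivity))).and self_mem_nhdsWithin).exists
    have ht0 : 0 < t := ht0
    rw [lt_div_iff₀ hM0] at htr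
    rw [lt_div_iff₀ hK0] at htK
    obtain ⟨z, rfl⟩ : ∃ z, y = x + t • z :=
      ⟨t⁻¹ • (y - x), by rw [smul_inv_smul₀ ht0.ne']; abel⟩
    simp only [add_sub_cancel_left, norm_smul, Real.norm_eq_abs, abs_of_pos ht0] at hy1
    have hz : ‖z‖ ≤ M := le_of_mul_le_mul_left hy1 ht0
    have hs := hsupp _ hys
    rw [add_sub_cancel_left, real_inner_smul_right] at hs
    obtain ⟨hT, hm⟩ := hball (t • z) (by
      rw [mem_ball_zero_iff, norm_smul, Real.norm_eq_abs, abs_of_pos ht0]; linarith)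
    rw [← hpdef, ← hA, map_smul, real_inner_smul_left, real_inner_smul_right,
      real_inner_smul_right, norm_smul, Real.norm_eq_abs, abs_of_pos ht0] at hT
    have hCS : -(‖p‖ * M) ≤ ⟪p, z⟫ := by
      have h1 := neg_le_of_abs_le (abs_real_inner_le_norm p z)
      have h2 : ‖p‖ * ‖z‖ ≤ ‖p‖ * M := by gcongr
      linarith
    refine ⟨z, hz, ?_, ?_⟩
    · have : t * ⟪p, z⟫ ≤ t * (-(‖p‖ * M) + ε) := by nlinarith
      exact le_of_mul_le_mul_left this ht0
    · have h1 : ε / (4 * M ^ 2) * (t * ‖z‖) ^ 2 ≤ t ^ 2 * (ε / 4) := by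
        calc ε / (4 * M ^ 2) * (t * ‖z‖) ^ 2 ≤ ε / (4 * M ^ 2) * (t * M) ^ 2 := by gcongr
          _ = t ^ 2 * (ε / 4) := by field_simp
      have h2 : t * -(‖p‖ * M) ≤ t * ⟪p, z⟫ := by gcongr
      have h3 : t ^ 2 * ⟪A z, z⟫ ≤ t ^ 2 * ((‖p‖ ^ 2 + 1 / 2) * M + ε) := by
        nlinarith
      exact le_of_mul_le_mul_left h3 (by positivity)
  have hgM : g x = -M := by linarith
  rw [Ffun, hgM]
  have h1 : M * ⟪A p, p⟫ ≤ (‖p‖ ^ 2 + 1 / 2) * ‖p‖ ^ 2 := by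
    refine le_of_mul_le_mul_left (?_ : M * _ ≤ M * _) hM0
    linarith
  have h2 : -⟪A p, p⟫ - 1 / -M * (‖p‖ ^ 4 + 1 / 2 * ‖p‖ ^ 2)
      = ((‖p‖ ^ 2 + 1 / 2) * ‖p‖ ^ 2 - M * ⟪A p, p⟫) / M := by
    field_simp
    ring
  rw [h2]
  exact div_nonneg (by linarith) hM0.le

theorem lamMin_mul_sq_le {n : ℕ} (A : EuclideanSpace ℝ (Fin n) →L[ℝ] EuclideanSpace ℝ (Fin n))
    (z : EuclideanSpace ℝ (Fin n)) : lamMin A * ‖z‖ ^ 2 ≤ ⟪A z, z⟫ := by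
  obtain rfl | hz := eq_or_ne z 0
  · simp
  have hz0 : 0 < ‖z‖ := norm_pos_iff.2 hz
  have hbd : BddBelow ((fun v => ⟪A v, v⟫) '' {v | ‖v‖ = 1}) := by
    refine ⟨-‖A‖, ?_⟩
    rintro _ ⟨v, hv, rfl⟩
    have hv : ‖v‖ = 1 := hv
    have h1 := neg_le_of_abs_le (abs_real_inner_le_norm (A v) v)
    have h2 := A.le_opNorm v
    rw [hv, mul_one] at h1 h2
    exact (neg_le_neg h2).trans h1
  have h1 : lamMin A ≤ ⟪A (‖z‖⁻¹ • z), ‖z‖⁻¹ • z⟫ :=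
    csInf_le hbd ⟨‖z‖⁻¹ • z, norm_smul_inv_norm hz, rfl⟩
  rw [map_smul, real_inner_smul_left, real_inner_smul_right] at h1
  calc lamMin A * ‖z‖ ^ 2 ≤ ‖z‖⁻¹ * (‖z‖⁻¹ * ⟪A z, z⟫) * ‖z‖ ^ 2 := by gcongr
    _ = ⟪A z, z⟫ := by field_simp

/-- For a function satisfying the differential inequality in the viscosity sense, the restriction
on test functions with vanishing gradient is automatic. -/
theorem lamMin_hessianCLM_le_of_forall_Ffun_nonneg {n : ℕ} {Ω : Set (EuclideanSpace ℝ (Fin n))}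
    {g ψ : EuclideanSpace ℝ (Fin n) → ℝ} {x : EuclideanSpace ℝ (Fin n)} (hΩ : IsOpen Ω)
    (hgc : ContinuousOn g Ω) (hneg : ∀ y ∈ Ω, g y < 0)
    (hF : ∀ y ∈ Ω, ∀ φ : EuclideanSpace ℝ (Fin n) → ℝ, ContDiffAt ℝ 2 φ y →
      IsLocalMin (fun y => g y - φ y) y → 0 ≤ Ffun (g y) (gradient φ y) (hessianCLM φ y))
    (hx : x ∈ Ω) (hψ : ContDiffAt ℝ 2 ψ x) (hmin : IsLocalMin (fun y => g y - ψ y) x)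
    (hp : gradient ψ x = 0) : lamMin (hessianCLM ψ x) ≤ -1 / (2 * g x) := by
  by_contra! hcon
  set A := hessianCLM ψ x with hA
  have hgx := hneg x hx
  have h0 : 0 < -1 / (2 * g x) := div_pos_of_neg_of_neg (by norm_num) (by linarith)
  obtain ⟨b, hb1, hb2⟩ := exists_between hcon
  have hb0 : 0 < b := h0.trans hb1
  have hbM : 1 / 2 < b * -g x := by
    rw [div_lt_iff_of_neg (by linarith)] at hb1
    linarith
  obtain ⟨e, he⟩ : ∃ e : EuclideanSpace ℝ (Fin n), ‖e‖ = 1 := by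
    by_contra! hne
    have : {v : EuclideanSpace ℝ (Fin n) | ‖v‖ = 1} = ∅ := by
      ext v
      simpa using hne v
    have h1 : lamMin A = 0 := by simp [lamMin, this]
    linarith
  obtain ⟨c, hc⟩ : ∃ c, c = (lamMin A - b) / 4 := ⟨_, rfl⟩
  have hc0 : 0 < c := by rw [hc]; linarith
  obtain ⟨μ, hμ1, hμ2⟩ := exists_between hbM
  have hshift : Tendsto (fun z => x + z) (𝓝 0) (𝓝 x) := by
    simpa using (continuous_const_add x).tendsto 0
  have hgcx : ContinuousAt g x := hgc.continuousAt (hΩ.mem_nhds hx)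
  obtain ⟨R, hR, hball⟩ := Metric.eventually_nhds_iff_ball.1
    (((hψ.eventually_taylor_two_le hc0).and (hshift.eventually hmin)).and
      (hshift.eventually ((hΩ.eventually_mem hx).and
        ((hgcx.neg.const_mul b).eventually (lt_mem_nhds hμ2)))))
  have hgrow : ∀ z ∈ ball (0 : EuclideanSpace ℝ (Fin n)) R,
      g x + (b / 2 + c) * ‖z‖ ^ 2 ≤ g (x + z) := by
    intro z hz
    obtain ⟨⟨hT, hm⟩, -⟩ := hball z hz
    have h1 := lamMin_mul_sq_le A z
    have h2 : lamMin A = b + 4 * c := by rw [hc]; ring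
    rw [hp, inner_zero_left] at hT
    rw [h2] at h1
    simp only at hm
    nlinarith
  have hsmall : ∀ᶠ δ in 𝓝[>] (0 : ℝ), b * δ / c < R / 2 ∧
      (b * (b * δ / c + δ)) ^ 2 < μ - 1 / 2 := by
    have h1 : Continuous fun δ : ℝ => b * δ / c := by fun_prop
    have h2 : Continuous fun δ : ℝ => (b * (b * δ / c + δ)) ^ 2 := by fun_prop
    exact eventually_nhdsWithin_of_eventually_nhds
      ((h1.tendsto 0 |>.eventually (gt_mem_nhds (by simpa using hR))).and
        (h2.tendsto 0 |>.eventually (gt_mem_nhds (by simpa using hμ1))))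
  obtain ⟨δ, ⟨hδR, hδμ⟩, hδ0⟩ := (hsmall.and self_mem_nhdsWithin).exists
  have hδ0 : 0 < δ := hδ0
  set d : EuclideanSpace ℝ (Fin n) := δ • e with hd
  have hdn : ‖d‖ = δ := by
    rw [hd, norm_smul, he, mul_one, Real.norm_eq_abs, abs_of_pos hδ0]
  have hsub : ∀ y ∈ closedBall x (R / 2), y - x ∈ ball (0 : EuclideanSpace ℝ (Fin n)) R := by
    intro y hy
    have := mem_closedBall_iff_norm.1 hy
    rw [mem_ball_zero_iff]
    linarith
  have hin : ∀ y ∈ closedBall x (R / 2), y ∈ Ω ∧ μ < b * -g y := by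
    intro y hy
    have := (hball _ (hsub y hy)).2
    rwa [add_sub_cancel] at this
  obtain ⟨y, hy, hymin⟩ := (isCompact_closedBall x (R / 2)).exists_isMinOn
    (nonempty_closedBall.2 (by positivity))
    ((hgc.mono fun y hy => (hin y hy).1).sub
      (continuous_radialParabola (x + d) 0 0 b).continuousOn)
  have hle : c * ‖y - x‖ ^ 2 + b * ⟪y - x, d⟫ ≤ 0 := by
    have h1 : g y - radialParabola (x + d) 0 0 b y ≤ g x - radialParabola (x + d) 0 0 b x :=
      hymin (mem_closedBall_self (by positivity))
    have h2 := hgrow _ (hsub y hy)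
    rw [add_sub_cancel] at h2
    have h3 : ‖y - (x + d)‖ ^ 2 = ‖y - x‖ ^ 2 - 2 * ⟪y - x, d⟫ + ‖d‖ ^ 2 := by
      rw [← sub_sub, norm_sub_sq_real]
    have h4 : ‖x - (x + d)‖ = ‖d‖ := by rw [sub_add_cancel_left, norm_neg]
    simp only [radialParabola, h3, h4] at h1
    nlinarith
  have hyx : ‖y - x‖ ≤ b * δ / c := by
    rw [le_div_iff₀ hc0]
    have h1 := neg_le_of_abs_le (abs_real_inner_le_norm (y - x) d)
    rw [hdn] at h1
    by_contra! hlt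
    have h2 : 0 < ‖y - x‖ := by
      by_contra! hn
      have : 0 < b * δ := by positivity
      nlinarith
    nlinarith
  have hyc : y ≠ x + d := by
    intro h
    rw [h, add_sub_cancel_left, real_inner_self_eq_norm_sq, hdn] at hle
    have : 0 < c * δ ^ 2 + b * δ ^ 2 := by positivity
    linarith
  have hyb : y ∈ ball x (R / 2) := mem_ball_iff_norm.2 (hyx.trans_lt hδR)
  have hloc : IsLocalMin (fun y => g y - radialParabola (x + d) 0 0 b y) y :=
    hymin.isLocalMin (mem_of_superset (isOpen_ball.mem_nhds hyb) ball_subset_closedBall)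
  obtain ⟨hyΩ, hyμ⟩ := hin y hy
  have hpos : 0 < ‖y - (x + d)‖ := norm_pos_iff.2 (sub_ne_zero.2 hyc)
  have key := mul_neg_le_of_Ffun_radialParabola_nonneg hyc (hneg y hyΩ)
    (by rw [sub_zero]; positivity)
    (hF y hyΩ _ (contDiffAt_radialParabola hyc 0 0 b) hloc)
  have hdist : ‖y - (x + d)‖ ≤ b * δ / c + δ := by
    rw [← sub_sub]
    exact (norm_sub_le _ _).trans (by rw [hdn]; gcongr)
  have : (b * ‖y - (x + d)‖ - 0) ^ 2 ≤ (b * (b * δ / c + δ)) ^ 2 := by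
    rw [sub_zero]
    gcongr
  linarith

/-- If `Ω` satisfies an interior sphere condition and `w` is a restricted
viscosity supersolution of `F(w,∇w,∇²w) = 0` vanishing on `∂Ω` and negative inside, then
its convex envelope `w_**` also vanishes on `∂Ω` and is a restricted viscosity
supersolution of the same equation. -/
theorem convex_envelope_restricted_supersol (n : ℕ)
    (Ω : Set (EuclideanSpace ℝ (Fin n)))
    (hΩo : IsOpen Ω) (hΩb : Bornology.IsBounded Ω) (hΩc : Convex ℝ Ω)
    (hsphere : InteriorSphere Ω)
    (w : EuclideanSpace ℝ (Fin n) → ℝ)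
    (hwc : ContinuousOn w (closure Ω))
    (hwneg : ∀ x ∈ Ω, w x < 0)
    (hw0 : ∀ x ∈ frontier Ω, w x = 0)
    (hres : IsRestrictedSupersol Ω w)
    (wss : EuclideanSpace ℝ (Fin n) → ℝ)
    (hconv : ConvexOn ℝ (closure Ω) wss)
    (hle : ∀ y ∈ closure Ω, wss y ≤ w y)
    (hmax : ∀ g : EuclideanSpace ℝ (Fin n) → ℝ, ConvexOn ℝ (closure Ω) g →
      (∀ y ∈ closure Ω, g y ≤ w y) → ∀ y ∈ closure Ω, g y ≤ wss y) :
    (∀ x ∈ frontier Ω, wss x = 0) ∧ IsRestrictedSupersol Ω wss := by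
  have hcpt : IsCompact (closure Ω) := hΩb.isCompact_closure
  have hneg : ∀ y ∈ Ω, wss y < 0 := fun y hy => (hle y (subset_closure hy)).trans_lt (hwneg y hy)
  have hc : ContinuousOn wss Ω := (hconv.subset subset_closure hΩc).continuousOn hΩo
  have hF : ∀ y ∈ Ω, ∀ φ : EuclideanSpace ℝ (Fin n) → ℝ, ContDiffAt ℝ 2 φ y →
      IsLocalMin (fun y => wss y - φ y) y →
      0 ≤ Ffun (wss y) (gradient φ y) (hessianCLM φ y) := by
    intro y hy φ hφ hmin
    by_cases hp : gradient φ y = 0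
    · simp [Ffun, hp]
    have hsupp : ∀ z ∈ closure Ω, wss y + ⟪gradient φ y, z - y⟫ ≤ wss z := fun z hz =>
      hconv.add_inner_gradient_le_of_isLocalMin (subset_closure hy)
        (hφ.differentiableAt (by norm_num)) hmin hz
    exact Ffun_nonneg_of_descent (hneg y hy) hφ hmin hp hsupp fun ε hε =>
      eventually_exists_convexEnvelope_le_parabola hΩo hcpt hwc hwneg hw0 hres hconv hle hmax hy hp
        hsupp hε
  refine ⟨fun x hx => convexEnvelope_eq_zero_on_frontier hΩo hcpt hΩc hwc hw0 hle hmax hx,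
    hc.lowerSemicontinuousOn, fun x hx ψ hψ hψx hψle => ?_⟩
  have hψ' : ContDiffAt ℝ 2 ψ x := hψ.contDiffAt (hΩo.mem_nhds hx)
  have hmin : IsLocalMin (fun y => wss y - ψ y) x := by
    filter_upwards [hΩo.mem_nhds hx] with y hy
    simpa [hψx] using hψle y hy
  exact ⟨hF x hx ψ hψ' hmin,
    lamMin_hessianCLM_le_of_forall_Ffun_nonneg hΩo hc hneg hF hx hψ' hmin⟩
end

section
/- Let Ω ⊆ ℝ^n be open and let u : Ω → [0,∞) be a nonnegative lower semicontinuous viscosity supersolution of −Δ∞^N u = 1 in Ω. Then u(x) > 0 for every x ∈ Ω. -/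
open Set Metric Filter
open scoped RealInnerProductSpace

/-- A nonnegative lower semicontinuous viscosity supersolution of
`-Δ∞^N u = 1` is strictly positive. -/
theorem supersol_pos (n : ℕ) (Ω : Set (EuclideanSpace ℝ (Fin n))) (hΩo : IsOpen Ω)
    (u : EuclideanSpace ℝ (Fin n) → ℝ)
    (hnonneg : ∀ x ∈ Ω, 0 ≤ u x)
    (hlsc : LowerSemicontinuousOn u Ω)
    (hsup : IsNSupersol Ω (fun _ => 1) u) :
    ∀ x ∈ Ω, 0 < u x := by
  intro x hx
  refine (hnonneg x hx).lt_of_ne fun h => ?_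
  have hgrad : gradient (fun _ : EuclideanSpace ℝ (Fin n) => (0 : ℝ)) = fun _ => 0 := by
    funext y
    exact gradient_const y 0
  have hlam : lamMin (hessianCLM (fun _ : EuclideanSpace ℝ (Fin n) => (0 : ℝ)) x) = 0 := by
    have hH : hessianCLM (fun _ : EuclideanSpace ℝ (Fin n) => (0 : ℝ)) x = 0 := by
      simp [hessianCLM, hgrad]
    rw [hH, lamMin]
    refine le_antisymm (Real.sInf_nonpos ?_) (Real.sInf_nonneg ?_) <;>
      rintro _ ⟨v, -, rfl⟩ <;> simp
  have htest := (hsup.2 x hx (fun _ => 0) contDiffOn_const h hnonneg).2 (congrFun hgrad x)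
  rw [hlam] at htest
  norm_num at htest
end

section
/- Let Ω ⊂ ℝ^n be open and bounded, and let u ∈ C(cl Ω) be a viscosity solution of the Dirichlet problem −Δ∞^N u = 1 in Ω, u = 0 on ∂Ω. Then for every ball B_R(y) ⊆ Ω and every x ∈ B_R(y), one has u(x) ≥ u(y)·(1 − |x−y|/R). -/
open Set Metric Filter
open scoped RealInnerProductSpace

section SmoothedCone

variable {n : ℕ}

/-- The cone `a - k|z - y|`, smoothed at its vertex `y` so that it stays below the cone. -/
noncomputable def smoothedCone (y : EuclideanSpace ℝ (Fin n)) (a k e : ℝ)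
    (z : EuclideanSpace ℝ (Fin n)) : ℝ :=
  a - k * √(‖z - y‖ ^ 2 + e)

variable (y : EuclideanSpace ℝ (Fin n)) (a k : ℝ) {e : ℝ}

theorem contDiff_smoothedCone (he : 0 < e) : ContDiff ℝ 2 (smoothedCone y a k e) := by
  unfold smoothedCone
  refine contDiff_const.sub (contDiff_const.mul (ContDiff.sqrt ?_ fun z => by positivity))
  exact ((contDiff_id.sub contDiff_const).norm_sq ℝ).add contDiff_const

theorem hasFDerivAt_sqrt_norm_sub_sq_add (he : 0 < e) (z : EuclideanSpace ℝ (Fin n)) :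
    HasFDerivAt (fun z => √(‖z - y‖ ^ 2 + e))
      ((1 / √(‖z - y‖ ^ 2 + e)) • innerSL ℝ (z - y)) z := by
  have h := ((((hasFDerivAt_id z).sub_const y).norm_sq).add_const e).sqrt
    (ne_of_gt (by positivity))
  refine h.congr_fderiv ?_
  ext v
  simp only [smul_apply, ContinuousLinearMap.comp_apply,
    ContinuousLinearMap.id_apply, id, smul_eq_mul, nsmul_eq_mul]
  push_cast
  ring

theorem gradient_smoothedCone (he : 0 < e) :
    gradient (smoothedCone y a k e) = fun z => -(k / √(‖z - y‖ ^ 2 + e)) • (z - y) := by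
  ext1 z
  refine HasGradientAt.gradient ?_
  rw [hasGradientAt_iff_hasFDerivAt]
  refine (((hasFDerivAt_sqrt_norm_sub_sq_add y he z).const_mul k).const_sub a).congr_fderiv ?_
  ext v
  simp only [neg_apply, smul_apply, innerSL_apply_apply,
    smul_eq_mul, InnerProductSpace.toDual_apply_apply, real_inner_smul_left]
  ring

theorem hessianCLM_smoothedCone (he : 0 < e) (z v : EuclideanSpace ℝ (Fin n)) :
    hessianCLM (smoothedCone y a k e) z v =
      -(k / √(‖z - y‖ ^ 2 + e)) • v +
        (k * ⟪z - y, v⟫ / √(‖z - y‖ ^ 2 + e) ^ 3) • (z - y) := by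
  have hs : √(‖z - y‖ ^ 2 + e) ≠ 0 := (Real.sqrt_pos.2 (by positivity)).ne'
  have hg : gradient (smoothedCone y a k e) =
      fun z => (-k * (√(‖z - y‖ ^ 2 + e))⁻¹) • (z - y) := by
    rw [gradient_smoothedCone y a k he]
    ext1 z
    rw [← neg_mul_eq_neg_mul, div_eq_mul_inv]
  have h := (((hasDerivAt_inv hs).comp_hasFDerivAt z
    (hasFDerivAt_sqrt_norm_sub_sq_add y he z)).const_mul (-k)).smul
    ((hasFDerivAt_id z).sub_const y)
  rw [hessianCLM, hg]
  refine (congrArg (· v) (HasFDerivAt.fderiv h)).trans ?_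
  simp only [add_apply, smul_apply,
    ContinuousLinearMap.smulRight_apply, ContinuousLinearMap.id_apply, innerSL_apply_apply,
    smul_eq_mul, id, Function.comp_apply]
  congr 2
  · ring
  · field_simp

theorem norm_gradient_smoothedCone_sq (he : 0 < e) (z : EuclideanSpace ℝ (Fin n)) :
    ‖gradient (smoothedCone y a k e) z‖ ^ 2 =
      k ^ 2 * ‖z - y‖ ^ 2 / √(‖z - y‖ ^ 2 + e) ^ 2 := by
  rw [gradient_smoothedCone y a k he, norm_smul, mul_pow, Real.norm_eq_abs, sq_abs]
  ring

theorem infLap_smoothedCone (he : 0 < e) (z : EuclideanSpace ℝ (Fin n)) :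
    infLap (smoothedCone y a k e) z =
      -(k ^ 3 * ‖z - y‖ ^ 2 * e / √(‖z - y‖ ^ 2 + e) ^ 5) := by
  have hs : 0 < √(‖z - y‖ ^ 2 + e) := Real.sqrt_pos.2 (by positivity)
  have hs2 : e = √(‖z - y‖ ^ 2 + e) ^ 2 - ‖z - y‖ ^ 2 := by
    rw [Real.sq_sqrt (by positivity)]; ring
  rw [infLap, hessianCLM_smoothedCone y a k he, gradient_smoothedCone y a k he]
  simp only [inner_add_left, real_inner_smul_left, real_inner_smul_right,
    real_inner_self_eq_norm_sq]
  generalize √(‖z - y‖ ^ 2 + e) = s at hs hs2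
  rw [hs2]
  field_simp
  ring

end SmoothedCone

/-- The minimum principle: the solution of the Dirichlet problem is nonnegative. -/
theorem IsDirichletSol.nonneg {n : ℕ} {Ω : Set (EuclideanSpace ℝ (Fin n))}
    (hΩo : IsOpen Ω) (hΩb : Bornology.IsBounded Ω) {u : EuclideanSpace ℝ (Fin n) → ℝ}
    (hu : IsDirichletSol Ω u) {x : EuclideanSpace ℝ (Fin n)} (hx : x ∈ closure Ω) : 0 ≤ u x := by
  obtain ⟨hc, hbd, -, -, hsup⟩ := hu
  obtain ⟨x₀, hx₀, hmin⟩ := hΩb.isCompact_closure.exists_isMinOn ⟨x, hx⟩ hc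
  by_cases hmem : x₀ ∈ Ω
  · have h := (hsup x₀ hmem (fun _ => u x₀) contDiffOn_const rfl
      fun z hz => hmin (subset_closure hz)).2
    have hgrad : gradient (fun _ : EuclideanSpace ℝ (Fin n) => u x₀) = fun _ => 0 := by
      ext1 z
      simp
    have hlam : lamMin (0 : EuclideanSpace ℝ (Fin n) →L[ℝ] EuclideanSpace ℝ (Fin n)) = 0 := by
      rcases Set.eq_empty_or_nonempty {v : EuclideanSpace ℝ (Fin n) | ‖v‖ = 1} with h0 | h0
      · simp [lamMin, h0]
      · simp [lamMin, h0.image_const]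
    have hhess : hessianCLM (fun _ : EuclideanSpace ℝ (Fin n) => u x₀) x₀ = 0 := by
      rw [hessianCLM, hgrad]
      simp
    have := h (by rw [hgrad])
    rw [hhess, hlam] at this
    norm_num at this
  · have : u x₀ = 0 := hbd x₀ (by rw [hΩo.frontier_eq]; exact ⟨hx₀, hmem⟩)
    exact this ▸ hmin hx

/-- Cone comparison estimate: the solution of the Dirichlet problem
satisfies `u(x) ≥ u(y)(1 - |x-y|/R)` on every ball `B_R(y) ⊆ Ω`. -/
theorem cone_lower_bound (n : ℕ) (Ω : Set (EuclideanSpace ℝ (Fin n)))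
    (hΩo : IsOpen Ω) (hΩb : Bornology.IsBounded Ω)
    (u : EuclideanSpace ℝ (Fin n) → ℝ) (hu : IsDirichletSol Ω u)
    (y : EuclideanSpace ℝ (Fin n)) (R : ℝ) (hR : 0 < R) (hball : ball y R ⊆ Ω)
    (x : EuclideanSpace ℝ (Fin n)) (hx : x ∈ ball y R) :
    u y * (1 - ‖x - y‖ / R) ≤ u x := by
  have hpos := fun z hz => hu.nonneg hΩo hΩb (x := z) hz
  obtain ⟨hc, -, -, -, hsup⟩ := hu
  have hyΩ : y ∈ Ω := hball (mem_ball_self hR)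
  have hxR : ‖x - y‖ < R := by simpa [dist_eq_norm] using hx
  rcases (hpos y (subset_closure hyΩ)).eq_or_lt with h0 | h0
  · simpa [← h0] using hpos x (subset_closure (hball hx))
  by_contra! hlt
  set k := u y / R with hk
  have hk0 : 0 < k := div_pos h0 hR
  have hkR : k * R = u y := div_mul_cancel₀ _ hR.ne'
  have hlt' : u x - (u y - k * ‖x - y‖) < 0 := by
    have : u y * (1 - ‖x - y‖ / R) = u y - k * ‖x - y‖ := by rw [hk]; ring
    linarith
  obtain ⟨δ, hδ, hδx⟩ : ∃ δ > 0, u x - (u y - k * ‖x - y‖) < -δ :=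
    ⟨-(u x - (u y - k * ‖x - y‖)) / 2, by linarith, by linarith⟩
  obtain ⟨r, hr, hnear⟩ : ∃ r > 0, ∀ z ∈ closure Ω, ‖z - y‖ < r → -δ < u z - u y := by
    obtain ⟨r, hr, h⟩ := Metric.continuousWithinAt_iff.1 (hc y (subset_closure hyΩ)) δ hδ
    refine ⟨r, hr, fun z hz hzr => ?_⟩
    have := h hz (by rwa [dist_eq_norm])
    rw [Real.dist_eq] at this
    exact (abs_lt.1 this).1
  obtain ⟨e, he, hex, hek⟩ : ∃ e > 0, u x - smoothedCone y (u y) k e x < -δ ∧ k * e < r ^ 3 := by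
    have h1 : Tendsto (fun e => u x - smoothedCone y (u y) k e x) (nhdsWithin 0 (Ioi 0))
        (nhds (u x - (u y - k * ‖x - y‖))) := by
      have : Continuous fun e => u x - smoothedCone y (u y) k e x := by
        unfold smoothedCone; fun_prop
      have h := this.tendsto 0
      simp only [smoothedCone, add_zero, Real.sqrt_sq (norm_nonneg _)] at h
      exact h.mono_left nhdsWithin_le_nhds
    have h2 : Tendsto (fun e : ℝ => k * e) (nhdsWithin 0 (Ioi 0)) (nhds 0) := by
      have h := (continuous_const_mul k).tendsto 0
      rw [mul_zero] at h
      exact h.mono_left nhdsWithin_le_nhds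
    obtain ⟨e, he, he'⟩ := ((h1.eventually_lt_const hδx).and
      (h2.eventually_lt_const (show 0 < r ^ 3 by positivity))).and self_mem_nhdsWithin |>.exists
    exact ⟨e, he', he⟩
  have hsm := contDiff_smoothedCone y (u y) k he
  obtain ⟨z, hz, hmin⟩ := hΩb.isCompact_closure.exists_isMinOn ⟨y, subset_closure hyΩ⟩
    (hc.sub hsm.continuous.continuousOn)
  have hzx : u z - smoothedCone y (u y) k e z < -δ :=
    (hmin (subset_closure (hball hx))).trans_lt hex
  have hsqrt : ‖z - y‖ ≤ √(‖z - y‖ ^ 2 + e) := Real.le_sqrt_of_sq_le (by linarith)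
  have hcone : smoothedCone y (u y) k e z ≤ u y - k * ‖z - y‖ :=
    sub_le_sub_left (mul_le_mul_of_nonneg_left hsqrt hk0.le) _
  have hzr : r ≤ ‖z - y‖ := by
    by_contra! h
    have := hnear z hz h
    have := mul_nonneg hk0.le (norm_nonneg (z - y))
    linarith
  have hzΩ : z ∈ Ω := by
    refine hball ?_
    rw [mem_ball, dist_eq_norm]
    by_contra! h
    have := hpos z hz
    have := mul_le_mul_of_nonneg_left h hk0.le
    linarith
  set m := u z - smoothedCone y (u y) k e z with hm
  have hshift : smoothedCone y (u y + m) k e = fun w => smoothedCone y (u y) k e w + m := by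
    ext1 w
    simp only [smoothedCone]
    ring
  have htest := (hsup z hzΩ (smoothedCone y (u y + m) k e)
    (contDiff_smoothedCone y _ k he).contDiffOn (by rw [hshift, hm]; ring) fun w hw => by
      have : m ≤ u w - smoothedCone y (u y) k e w := hmin (subset_closure hw)
      rw [hshift]
      linarith).1
  have hz0 : 0 < ‖z - y‖ := hr.trans_le hzr
  have hs : 0 < √(‖z - y‖ ^ 2 + e) := hz0.trans_le hsqrt
  have hgrad : 0 < ‖gradient (smoothedCone y (u y + m) k e) z‖ ^ 2 := by
    rw [norm_gradient_smoothedCone_sq y _ k he]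
    positivity
  have hineq := htest fun h => by simp [h] at hgrad
  rw [norm_gradient_smoothedCone_sq y _ k he, infLap_smoothedCone y _ k he, one_mul, neg_neg]
    at hineq
  have hrs : r ^ 3 ≤ √(‖z - y‖ ^ 2 + e) ^ 3 := pow_le_pow_left₀ hr.le (hzr.trans hsqrt) 3
  generalize √(‖z - y‖ ^ 2 + e) = s at hs hrs hineq
  have hstep : k ^ 3 * ‖z - y‖ ^ 2 * e / s ^ 5 =
      k ^ 2 * ‖z - y‖ ^ 2 / s ^ 2 * (k * e / s ^ 3) := by
    field_simp
  have hfrac : k * e / s ^ 3 < 1 := (div_lt_one (by positivity)).2 (hek.trans_le hrs)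
  rw [hstep] at hineq
  exact (mul_lt_of_lt_one_right (by positivity) hfrac).not_ge hineq
end

section
/- Let Ω ⊂ ℝ^n be an open bounded convex set, let ε ∈ (0,1], and let Ω_ε := { x ∈ ℝ^n : dist(x,Ω) < ε } be the outer parallel body. Let u_ε ∈ C(cl Ω_ε) be a viscosity solution of the Dirichlet problem −Δ∞^N u_ε = 1 in Ω_ε, u_ε = 0 on ∂Ω_ε. Then for every y ∈ ∂Ω one has u_ε(y) ≤ (ε/2)·diam(Ω_ε) − ε²/2. -/
open Set Metric Filter
open scoped RealInnerProductSpace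

/-- The radial profile `k (L r - r²) / 2` around `z`, with infinity Laplacian quotient `-k`. -/
noncomputable def polarBarrier {n : ℕ} (k L : ℝ) (z x : EuclideanSpace ℝ (Fin n)) : ℝ :=
  k * (L * ‖x - z‖ - ‖x - z‖ ^ 2) / 2

lemma continuous_polarBarrier {n : ℕ} (k L : ℝ) (z : EuclideanSpace ℝ (Fin n)) :
    Continuous (polarBarrier k L z) := by
  unfold polarBarrier
  fun_prop

lemma polarBarrier_nonneg {n : ℕ} {k L : ℝ} (hk : 0 ≤ k) {z x : EuclideanSpace ℝ (Fin n)}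
    (hx : ‖x - z‖ ≤ L) : 0 ≤ polarBarrier k L z x := by
  have h : 0 ≤ ‖x - z‖ * (L - ‖x - z‖) := mul_nonneg (norm_nonneg _) (by linarith)
  have := mul_nonneg hk h
  unfold polarBarrier
  linarith

lemma contDiffAt_polarBarrier {n : ℕ} (k L : ℝ) {z x : EuclideanSpace ℝ (Fin n)} (hx : x ≠ z) :
    ContDiffAt ℝ 2 (polarBarrier k L z) x := by
  have h1 : ContDiffAt ℝ 2 (fun x : EuclideanSpace ℝ (Fin n) => ‖x - z‖) x :=
    (contDiffAt_id.sub contDiffAt_const).norm ℝ (sub_ne_zero.2 hx)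
  unfold polarBarrier
  exact (contDiffAt_const.mul ((contDiffAt_const.mul h1).sub (h1.pow 2))).div_const 2

lemma hasGradientAt_polarBarrier_add_const {n : ℕ} (k L c : ℝ) {z x : EuclideanSpace ℝ (Fin n)}
    (hx : x ≠ z) : HasGradientAt (fun y => polarBarrier k L z y + c)
      ((k * (L / (2 * ‖x - z‖) - 1)) • (x - z)) x := by
  have hr : ‖x - z‖ ≠ 0 := norm_ne_zero_iff.2 (sub_ne_zero.2 hx)
  have hsq : HasFDerivAt (fun y : EuclideanSpace ℝ (Fin n) => ‖y - z‖ ^ 2)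
      (2 • innerSL ℝ (x - z)) x := by
    simpa using ((hasFDerivAt_id x).sub_const z).norm_sq
  have hsqrt : HasFDerivAt (fun y : EuclideanSpace ℝ (Fin n) => ‖y - z‖)
      ((1 / (2 * ‖x - z‖)) • 2 • innerSL ℝ (x - z)) x := by
    have := hsq.sqrt (pow_ne_zero 2 hr)
    simpa [Real.sqrt_sq (norm_nonneg _)] using this
  rw [hasGradientAt_iff_hasFDerivAt]
  have h := ((((hsqrt.const_mul L).sub hsq).const_mul k).mul_const (1 / 2)).add_const c
  refine (h.congr_fderiv ?_).congr_of_eventuallyEq (.of_forall fun y => ?_)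
  · ext v
    simp
    field_simp
  · simp only [polarBarrier, Pi.sub_apply]
    ring

lemma infLap_polarBarrier_add_const {n : ℕ} (k L c : ℝ) {z x : EuclideanSpace ℝ (Fin n)}
    (hx : x ≠ z) : infLap (fun y => polarBarrier k L z y + c) x =
      -k * ‖gradient (fun y => polarBarrier k L z y + c) x‖ ^ 2 := by
  set φ : EuclideanSpace ℝ (Fin n) → ℝ := fun y => polarBarrier k L z y + c
  set w := x - z
  have hw : w ≠ 0 := sub_ne_zero.2 hx
  have hr : ‖w‖ ≠ 0 := norm_ne_zero_iff.2 hw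
  have hgrad : ∀ y, y ≠ z → gradient φ y = (k * (L / (2 * ‖y - z‖) - 1)) • (y - z) := fun y hy =>
    (hasGradientAt_polarBarrier_add_const k L c hy).gradient
  have hdiff : DifferentiableAt ℝ (gradient φ) x := by
    have hsub : DifferentiableAt ℝ (fun y : EuclideanSpace ℝ (Fin n) => y - z) x :=
      differentiableAt_id.sub_const z
    have hquot : DifferentiableAt ℝ
        (fun y : EuclideanSpace ℝ (Fin n) => L / (2 * ‖y - z‖)) x := by
      simpa only [div_eq_mul_inv] using
        (((hsub.norm ℝ hw).const_mul 2).fun_inv (mul_ne_zero two_ne_zero hr)).const_mul L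
    have hscaled : DifferentiableAt ℝ
        (fun y : EuclideanSpace ℝ (Fin n) => (k * (L / (2 * ‖y - z‖) - 1)) • (y - z)) x :=
      ((hquot.sub_const 1).const_mul k).fun_smul hsub
    refine hscaled.congr_of_eventuallyEq ?_
    filter_upwards [isOpen_ne.mem_nhds hx] with y hy using hgrad y hy
  have hradial : fderiv ℝ (gradient φ) x w = -k • w := by
    have hline : HasDerivAt (fun t : ℝ => x + t • w) w 0 := by
      simpa using ((hasDerivAt_id (0 : ℝ)).smul_const w).const_add x
    have hcomp : HasDerivAt (fun t : ℝ => gradient φ (x + t • w))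
        (fderiv ℝ (gradient φ) x w) 0 :=
      hdiff.hasFDerivAt.comp_hasDerivAt_of_eq (0 : ℝ) hline (by simp)
    have hexp : HasDerivAt (fun t : ℝ => (k * (L / (2 * ‖w‖) - (1 + t))) • w) (-k • w) 0 := by
      have : HasDerivAt (fun t : ℝ => k * (L / (2 * ‖w‖) - (1 + t))) (-k) 0 := by
        simpa using (((hasDerivAt_id (0 : ℝ)).const_add 1).const_sub (L / (2 * ‖w‖))).const_mul k
      exact this.smul_const w
    refine hcomp.unique (hexp.congr_of_eventuallyEq ?_)
    filter_upwards [isOpen_Ioi.mem_nhds (show (0 : ℝ) ∈ Ioi (-1) by simp)] with t ht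
    have ht' : 0 < 1 + t := by have := mem_Ioi.1 ht; linarith
    have hsub : x + t • w - z = (1 + t) • w := by simp only [w]; module
    have hne : x + t • w ≠ z := by
      rw [← sub_ne_zero, hsub]
      exact smul_ne_zero ht'.ne' hw
    rw [hgrad _ hne, hsub, norm_smul, Real.norm_of_nonneg ht'.le, smul_smul]
    congr 1
    field_simp
  have hg : gradient φ x = (k * (L / (2 * ‖w‖) - 1)) • w := hgrad x hx
  unfold infLap hessianCLM
  rw [← real_inner_self_eq_norm_sq, hg, map_smul, hradial]
  simp only [inner_smul_left, inner_smul_right]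
  simp
  ring

/-- A subsolution can touch a strict polar barrier from below only on its critical sphere. -/
lemma IsNSubsol.norm_sub_eq_of_isMaxOn {n : ℕ} {Ω : Set (EuclideanSpace ℝ (Fin n))}
    {u : EuclideanSpace ℝ (Fin n) → ℝ} (hu : IsNSubsol Ω (fun _ => 1) u) {k L : ℝ} (hk : 1 < k)
    {z x : EuclideanSpace ℝ (Fin n)} (hz : z ∉ Ω) (hx : x ∈ Ω)
    (hmax : IsMaxOn (fun y => u y - polarBarrier k L z y) Ω x) : ‖x - z‖ = L / 2 := by
  have hne : ∀ y ∈ Ω, y ≠ z := fun y hy h => hz (h ▸ hy)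
  set c := u x - polarBarrier k L z x
  have hsub := (hu.2 x hx (fun y => polarBarrier k L z y + c)
    (fun y hy => ((contDiffAt_polarBarrier k L (hne y hy)).add contDiffAt_const).contDiffWithinAt)
    (by simp [c]) (fun y hy => by
      have : u y - polarBarrier k L z y ≤ c := hmax hy
      linarith)).1
  have hr : ‖x - z‖ ≠ 0 := norm_ne_zero_iff.2 (sub_ne_zero.2 (hne x hx))
  have hzero : gradient (fun y => polarBarrier k L z y + c) x = 0 := by
    by_contra hg
    have h := hsub hg
    rw [infLap_polarBarrier_add_const k L c (hne x hx)] at h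
    have : 0 < ‖gradient (fun y => polarBarrier k L z y + c) x‖ ^ 2 :=
      pow_pos (norm_pos_iff.2 hg) 2
    nlinarith
  rw [(hasGradientAt_polarBarrier_add_const k L c (hne x hx)).gradient, smul_eq_zero,
    or_iff_left (sub_ne_zero.2 (hne x hx)), mul_eq_zero,
    or_iff_right (by linarith : k ≠ 0)] at hzero
  field_simp at hzero
  linarith

/-- If the difference between a Dirichlet solution and a strict polar barrier is somewhere
positive, then its maximum is attained on the critical sphere of the barrier. -/
lemma IsDirichletSol.exists_isMaxOn_norm_sub_eq {n : ℕ} {Ω : Set (EuclideanSpace ℝ (Fin n))}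
    (hΩo : IsOpen Ω) (hΩb : Bornology.IsBounded Ω) {u : EuclideanSpace ℝ (Fin n) → ℝ}
    (hu : IsDirichletSol Ω u) {k L : ℝ} (hk : 1 < k) {y z : EuclideanSpace ℝ (Fin n)} (hz : z ∉ Ω)
    (hL : ∀ x ∈ closure Ω, ‖x - z‖ ≤ L) (hy : y ∈ Ω) (hpos : polarBarrier k L z y < u y) :
    ∃ x ∈ Ω, IsMaxOn (fun x => u x - polarBarrier k L z x) Ω x ∧ ‖x - z‖ = L / 2 := by
  obtain ⟨x, hx, hmax⟩ := hΩb.isCompact_closure.exists_isMaxOn ⟨y, subset_closure hy⟩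
    (hu.1.sub (continuous_polarBarrier k L z).continuousOn)
  have hval : u y - polarBarrier k L z y ≤ u x - polarBarrier k L z x := hmax (subset_closure hy)
  have hxΩ : x ∈ Ω := by
    by_contra hx'
    have h0 := hu.2.1 x (by rw [hΩo.frontier_eq]; exact ⟨hx, hx'⟩)
    have := polarBarrier_nonneg (by linarith : 0 ≤ k) (hL x hx)
    linarith
  have hmax' := hmax.on_subset subset_closure
  exact ⟨x, hxΩ, hmax', hu.2.2.1.norm_sub_eq_of_isMaxOn hk hz hxΩ hmax'⟩

/-- An open convex set has a unit outer normal at each of its boundary points. -/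
lemma Convex.exists_unit_normal {n : ℕ} {Ω : Set (EuclideanSpace ℝ (Fin n))}
    (hΩc : Convex ℝ Ω) (hΩo : IsOpen Ω) {y : EuclideanSpace ℝ (Fin n)} (hy : y ∈ frontier Ω) :
    ∃ ν : EuclideanSpace ℝ (Fin n), ‖ν‖ = 1 ∧ ∀ a ∈ Ω, ⟪a - y, ν⟫ < 0 := by
  rw [hΩo.frontier_eq] at hy
  obtain ⟨f, hf⟩ := geometric_hahn_banach_open_point hΩc hΩo hy.2
  set p := (InnerProductSpace.toDual ℝ (EuclideanSpace ℝ (Fin n))).symm f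
  have hp : ∀ a ∈ Ω, ⟪a - y, p⟫ < 0 := fun a ha => by
    rw [real_inner_comm, InnerProductSpace.toDual_symm_apply, map_sub]
    linarith [hf a ha]
  have hp0 : p ≠ 0 := by
    obtain ⟨a, ha⟩ := closure_nonempty_iff.1 ⟨y, hy.1⟩
    intro h
    simpa [h] using hp a ha
  refine ⟨‖p‖⁻¹ • p, norm_smul_inv_norm hp0, fun a ha => ?_⟩
  rw [inner_smul_right]
  exact mul_neg_of_pos_of_neg (inv_pos.2 (norm_pos_iff.2 hp0)) (hp a ha)

/-- Boundary estimate for the solution on the outer parallel body: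
for `y ∈ ∂Ω`, `u_ε(y) ≤ (ε/2)·diam(Ω_ε) - ε²/2`. -/
theorem outer_parallel_boundary_estimate (n : ℕ) (Ω : Set (EuclideanSpace ℝ (Fin n)))
    (hΩo : IsOpen Ω) (hΩb : Bornology.IsBounded Ω) (hΩc : Convex ℝ Ω)
    (ε : ℝ) (hε : ε ∈ Ioc (0 : ℝ) 1)
    (Ωε : Set (EuclideanSpace ℝ (Fin n))) (hΩε : Ωε = {x | infDist x Ω < ε})
    (uε : EuclideanSpace ℝ (Fin n) → ℝ) (huε : IsDirichletSol Ωε uε) :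
    ∀ y ∈ frontier Ω, uε y ≤ ε / 2 * diam Ωε - ε ^ 2 / 2 := by
  intro y hy
  obtain ⟨hε0, -⟩ := hε
  have hycl : y ∈ closure Ω := frontier_subset_closure hy
  have hne : Ω.Nonempty := closure_nonempty_iff.1 ⟨y, hycl⟩
  obtain ⟨ν, hν1, hν⟩ := hΩc.exists_unit_normal hΩo hy
  have hthick : Ωε = thickening ε Ω := by
    ext x
    rw [hΩε, mem_ofPred_eq, mem_thickening_iff_infDist_lt hne]
  have ho : IsOpen Ωε := hthick ▸ isOpen_thickening
  have hb : Bornology.IsBounded Ωε := hthick ▸ hΩb.thickening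
  have hhalf : ∀ x ∈ Ωε, ⟪x - y, ν⟫ < ε := by
    intro x hx
    obtain ⟨a, ha, hxa⟩ := mem_thickening_iff.1 (hthick ▸ hx)
    have h1 : ⟪x - a, ν⟫ ≤ ‖x - a‖ := by
      simpa [hν1] using real_inner_le_norm (x - a) ν
    have h2 : ⟪x - y, ν⟫ = ⟪x - a, ν⟫ + ⟪a - y, ν⟫ := by
      rw [← inner_add_left, sub_add_sub_cancel]
    rw [dist_eq_norm] at hxa
    linarith [hν a ha]
  have hray : ∀ s ∈ Ico 0 ε, y + s • ν ∈ Ωε := by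
    intro s hs
    rw [hΩε, mem_ofPred_eq, ← infDist_closure]
    refine (infDist_le_dist_of_mem hycl).trans_lt ?_
    rw [dist_eq_norm, add_sub_cancel_left, norm_smul, hν1, mul_one, Real.norm_of_nonneg hs.1]
    exact hs.2
  have hyΩ : y ∈ Ωε := by simpa using hray 0 ⟨le_rfl, hε0⟩
  have hzcl : y + ε • ν ∈ closure Ωε := by
    have hcont : Continuous fun s : ℝ => y + s • ν := by fun_prop
    have hε' : ε ∈ closure (Ico 0 ε) := by
      rw [closure_Ico hε0.ne]
      exact ⟨hε0.le, le_rfl⟩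
    exact closure_mono (image_subset_iff.2 hray) (image_closure_subset_closure_image hcont
      (mem_image_of_mem _ hε'))
  have hnotin : ∀ t, 0 ≤ t → y + (ε + t) • ν ∉ Ωε := by
    intro t ht h
    have := hhalf _ h
    rw [add_sub_cancel_left, inner_smul_left, real_inner_self_eq_norm_sq, hν1] at this
    simp at this
    linarith
  have hdist : ∀ t, 0 ≤ t → ∀ x ∈ closure Ωε, ‖x - (y + (ε + t) • ν)‖ ≤ diam Ωε + t := by
    intro t ht x hx
    have h1 : ‖x - (y + ε • ν)‖ ≤ diam Ωε := by
      rw [← diam_closure, ← dist_eq_norm]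
      exact dist_le_diam_of_mem hb.closure hx hzcl
    have h2 : x - (y + (ε + t) • ν) = (x - (y + ε • ν)) - t • ν := by module
    have h3 : ‖t • ν‖ = t := by rw [norm_smul, hν1, mul_one, Real.norm_of_nonneg ht]
    rw [h2]
    linarith [norm_sub_le (x - (y + ε • ν)) (t • ν)]
  by_contra! hlt
  set D := diam Ωε
  obtain ⟨t, ht0, ht1, ht2⟩ : ∃ t : ℝ, 0 < t ∧
      (1 + t) * ((D + t) * ε - ε ^ 2) / 2 < uε y ∧
      (1 + t) * ((D + t) * (ε + t) - (ε + t) ^ 2) / 2 < uε y := by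
    have h1 : ∀ᶠ t : ℝ in nhds 0, (1 + t) * ((D + t) * ε - ε ^ 2) / 2 < uε y := by
      have hc : Continuous fun t : ℝ => (1 + t) * ((D + t) * ε - ε ^ 2) / 2 := by fun_prop
      exact hc.continuousAt.eventually_lt_const (by linarith)
    have h2 : ∀ᶠ t : ℝ in nhds 0, (1 + t) * ((D + t) * (ε + t) - (ε + t) ^ 2) / 2 < uε y := by
      have hc : Continuous fun t : ℝ => (1 + t) * ((D + t) * (ε + t) - (ε + t) ^ 2) / 2 := by
        fun_prop
      exact hc.continuousAt.eventually_lt_const (by simp only [add_zero]; linarith)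
    obtain ⟨t, ⟨h1, h2⟩, ht⟩ :=
      (((h1.and h2).filter_mono nhdsWithin_le_nhds).and
        (self_mem_nhdsWithin : Ioi (0 : ℝ) ∈ nhdsWithin 0 (Ioi 0))).exists
    exact ⟨t, ht, h1, h2⟩
  have hnorm : ∀ s, 0 ≤ s → ‖y - (y + s • ν)‖ = s := by
    intro s hs
    rw [sub_add_cancel_left, norm_neg, norm_smul, hν1, mul_one, Real.norm_of_nonneg hs]
  have hk : (1 : ℝ) < 1 + t := by linarith
  -- The two barriers are centred at `y + ε ν` and `y + (ε + t) ν`; the maxima of the differences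
  -- cannot both lie on the critical spheres.
  obtain ⟨x₁, hx₁, hmax₁, hr₁⟩ := huε.exists_isMaxOn_norm_sub_eq ho hb (L := D + t) hk
    (z := y + ε • ν) (by simpa using hnotin 0 le_rfl)
    (fun x hx => (by simpa using hdist 0 le_rfl x hx : _ ≤ D).trans (by linarith)) hyΩ
    (by rw [polarBarrier, hnorm ε hε0.le]; exact ht1)
  obtain ⟨x₂, hx₂, hmax₂, hr₂⟩ := huε.exists_isMaxOn_norm_sub_eq ho hb hk
    (hnotin t ht0.le) (hdist t ht0.le) hyΩ
    (by rw [polarBarrier, hnorm (ε + t) (by linarith)]; exact ht2)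
  have h₁₂ := hmax₁ hx₂
  have h₂₁ := hmax₂ hx₁
  have hfar : ‖x₁ - (y + ε • ν)‖ ^ 2 < ‖x₁ - (y + (ε + t) • ν)‖ ^ 2 := by
    have h2 : x₁ - (y + (ε + t) • ν) = (x₁ - (y + ε • ν)) - t • ν := by module
    have h3 : ⟪x₁ - (y + ε • ν), ν⟫ < 0 := by
      rw [← sub_sub, inner_sub_left, inner_smul_left, real_inner_self_eq_norm_sq, hν1]
      simpa using hhalf x₁ hx₁
    rw [h2, norm_sub_sq_real (x₁ - (y + ε • ν)), inner_smul_right]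
    nlinarith [mul_neg_of_pos_of_neg ht0 h3, sq_nonneg ‖t • ν‖]
  have hfar' := lt_of_pow_lt_pow_left₀ 2 (norm_nonneg _) hfar
  simp only [mem_ofPred_eq, polarBarrier, hr₁, hr₂] at h₁₂ h₂₁
  rw [hr₁] at hfar'
  have hsq₁ := mul_pos (by linarith : (0 : ℝ) < 1 + t) (pow_pos (sub_pos.2 hfar') 2)
  have hsq₂ := mul_nonneg (by linarith : (0 : ℝ) ≤ 1 + t)
    (sq_nonneg (‖x₂ - (y + ε • ν)‖ - (D + t) / 2))
  linarith
end
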